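/- Fix c > 0 and η ∈ [0,1) with c < c̄(η), let ζ = ζ(c,η), and let λ : ℕ → (0,∞) be any sequence with √n·λ(n) → c. Then, with expectations taken with respect to μ_{λ(n),ζ} on graphs on n vertices: E|G| / n^{3/2} → (1/2)·√( W(2ζc²)/(2ζ) ) and E X(G) / n^{3/2} → ((1−ζ)/6)·( W(2ζc²)/(2ζ) )^{3/2} as n → ∞. Moreover, for every ε > 0, the μ_{λ(n),ζ}-probability of the event { | |G| − E|G| | ≤ ε·E|G| and |X(G) − E X(G)| ≤ ε·(E X(G) + n^{3/2}) } tends to 1. -/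

import Mathlib

open Filter
open scoped BigOperators symmDiff Classical

noncomputable section

/-- Number of edges of a labeled simple graph on `Fin n`. -/
def edgeCount {n : ℕ} (G : SimpleGraph (Fin n)) : ℕ := Nat.card G.edgeSet

/-- Number of triangles of a labeled simple graph on `Fin n`. -/
def triCount {n : ℕ} (G : SimpleGraph (Fin n)) : ℕ :=
  Nat.card {s : Finset (Fin n) // G.IsNClique 3 s}

/-- Probability of the event `A` under the Erdős–Rényi random graph `G(n,p)`. -/
def erProb (n : ℕ) (p : ℝ) (A : Set (SimpleGraph (Fin n))) : ℝ :=
  ∑ G : SimpleGraph (Fin n),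
    if G ∈ A then p ^ edgeCount G * (1 - p) ^ (n.choose 2 - edgeCount G) else 0

/-- Conditional probability `P_p(A | B)` for `G(n,p)`. -/
def erCondProb (n : ℕ) (p : ℝ) (A B : Set (SimpleGraph (Fin n))) : ℝ :=
  erProb n p (A ∩ B) / erProb n p B

/-- Probability of the event `A` under the uniform random graph `G(n,m)`. -/
def gnmProb (n m : ℕ) (A : Set (SimpleGraph (Fin n))) : ℝ :=
  (Nat.card {G : SimpleGraph (Fin n) // edgeCount G = m ∧ G ∈ A} : ℝ) /
    ((n.choose 2).choose m : ℝ)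

/-- Expected number of triangles of `G(n,m)`. -/
def gnmExpTri (n m : ℕ) : ℝ :=
  (∑ G : SimpleGraph (Fin n), if edgeCount G = m then (triCount G : ℝ) else 0) /
    ((n.choose 2).choose m : ℝ)

/-- Gibbs weight `λ^{|G|} (1-ζ)^{X(G)}`. -/
def gibbsWeight {n : ℕ} (lam zeta : ℝ) (G : SimpleGraph (Fin n)) : ℝ :=
  lam ^ edgeCount G * (1 - zeta) ^ triCount G

/-- The partition function `Z(λ,ζ)`. -/
def Zfun (n : ℕ) (lam zeta : ℝ) : ℝ := ∑ G : SimpleGraph (Fin n), gibbsWeight lam zeta G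

/-- Probability of the event `A` under the Gibbs measure `μ_{λ,ζ}`. -/
def gibbsProb (n : ℕ) (lam zeta : ℝ) (A : Set (SimpleGraph (Fin n))) : ℝ :=
  (∑ G : SimpleGraph (Fin n), if G ∈ A then gibbsWeight lam zeta G else 0) / Zfun n lam zeta

/-- Expectation of `f` under the Gibbs measure `μ_{λ,ζ}`. -/
def gibbsExp (n : ℕ) (lam zeta : ℝ) (f : SimpleGraph (Fin n) → ℝ) : ℝ :=
  (∑ G : SimpleGraph (Fin n), f G * gibbsWeight lam zeta G) / Zfun n lam zeta

/-- Number of edges of `H` with both endpoints in `S`. -/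
def edgesIn {V : Type*} (H : SimpleGraph V) (S : Finset V) : ℕ :=
  Nat.card {e : Sym2 V // e ∈ H.edgeSet ∧ ∀ v ∈ e, v ∈ S}

/-- Weight `λ^{|S|} (1-ζ)^{|E(S)|}` of the measure `ν_{H,λ,ζ}`. -/
def nuWeight {V : Type*} (H : SimpleGraph V) (lam zeta : ℝ) (S : Finset V) : ℝ :=
  lam ^ S.card * (1 - zeta) ^ edgesIn H S

/-- The partition function `Ξ_H(λ,ζ)`. -/
def XiFun {V : Type*} [Fintype V] (H : SimpleGraph V) (lam zeta : ℝ) : ℝ :=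
  ∑ S : Finset V, nuWeight H lam zeta S

/-- The probability of `S` under `ν_{H,λ,ζ}`. -/
def nuProb {V : Type*} [Fintype V] (H : SimpleGraph V) (lam zeta : ℝ) (S : Finset V) : ℝ :=
  nuWeight H lam zeta S / XiFun H lam zeta

/-- `W` is the Lambert-W function on `[0,∞)`: for `x ≥ 0`, `W x` is the unique `w ≥ 0`
with `w·e^w = x`. -/
def IsLambertW (W : ℝ → ℝ) : Prop :=
  ∀ x : ℝ, 0 ≤ x → (0 ≤ W x ∧ W x * Real.exp (W x) = x ∧
    ∀ w : ℝ, 0 ≤ w → w * Real.exp w = x → w = W x)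

/-- `η* = (W(2/e)/(2/e))^{3/2}`. -/
def etaStar (W : ℝ → ℝ) : ℝ := (W (2 / Real.exp 1) / (2 / Real.exp 1)) ^ ((3 : ℝ) / 2)

/-- The condition `c < c̄(η)` where `c̄(η) = 1/√(e(1−η/η*))` for `η < η*` and `+∞` otherwise. -/
def LtCbar (W : ℝ → ℝ) (c η : ℝ) : Prop :=
  η < etaStar W → c < 1 / Real.sqrt (Real.exp 1 * (1 - η / etaStar W))

/-- The left-hand side of the equation defining `ζ(c,η)`, interpreted as `1` at `ζ = 0`. -/
def zetaLHS (W : ℝ → ℝ) (c zeta : ℝ) : ℝ :=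
  (1 - zeta) * (if zeta = 0 then 1 else
    (W (2 * zeta * c ^ 2) / (2 * zeta * c ^ 2)) ^ ((3 : ℝ) / 2))

namespace TripleSystem

variable {E : Type*} [DecidableEq E]

/-- Gibbs weight of `S`, where a factor `1 - ζ` is paid for each member of `J` contained in `S`. -/
def weight (lam zeta : ℝ) (J : Finset (Finset E)) (S : Finset E) : ℝ :=
  lam ^ S.card * (1 - zeta) ^ (J.filter (· ⊆ S)).card

variable {lam zeta : ℝ} {N : ℕ} {H J K : Finset (Finset E)} {A B S T : Finset E} {e f g : E}

lemma weight_nonneg (hl : 0 < lam) (hz1 : zeta ≤ 1) : 0 ≤ weight lam zeta J S :=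
  mul_nonneg (pow_nonneg hl.le _) (pow_nonneg (sub_nonneg.2 hz1) _)

lemma weight_insert (hT : T ∉ K) :
    weight lam zeta (insert T K) S = weight lam zeta K S * (if T ⊆ S then 1 - zeta else 1) := by
  unfold weight
  rw [Finset.filter_insert]
  split_ifs with h
  · rw [Finset.card_insert_of_notMem (by simp [hT]), pow_succ]; ring
  · ring

lemma weight_anti (hl : 0 < lam) (hz : 0 ≤ zeta) (hz1 : zeta ≤ 1) (h : K ⊆ J) :
    weight lam zeta J S ≤ weight lam zeta K S := by
  unfold weight
  refine mul_le_mul_of_nonneg_left ?_ (pow_nonneg hl.le _)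
  exact pow_le_pow_of_le_one (by linarith) (by linarith)
    (Finset.card_le_card (Finset.filter_subset_filter _ h))

/-- Linear `3`-uniform `N`-regular hypergraphs. -/
structure IsSystem (H : Finset (Finset E)) (N : ℕ) : Prop where
  card_eq : ∀ T ∈ H, T.card = 3
  linear : ∀ T ∈ H, ∀ T' ∈ H, ∀ a b, a ≠ b → a ∈ T → b ∈ T → a ∈ T' → b ∈ T' → T = T'
  regular : ∀ e, (H.filter (e ∈ ·)).card = N

/-- All members of `H` disjoint from `A` are penalized, and adding `e` to `A` completes no
penalized triple. -/
structure Free (H J : Finset (Finset E)) (A : Finset E) (e : E) : Prop where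
  sub : J ⊆ H
  mem_of_disjoint : ∀ T ∈ H, Disjoint T A → T ∈ J
  notMem : e ∉ A
  not_subset : ∀ T ∈ J, ¬ T ⊆ insert e A

lemma Free.not_subset' (h : Free H J A e) : ∀ T ∈ J, ¬ T ⊆ A :=
  fun T hT hA => h.not_subset T hT (hA.trans (Finset.subset_insert e A))

lemma exists_eq_triple (hT : T.card = 3) (he : e ∈ T) :
    ∃ f g, f ≠ g ∧ f ≠ e ∧ g ≠ e ∧ T = {e, f, g} := by
  have h1 : (T.erase e).card = 2 := by rw [Finset.card_erase_of_mem he, hT]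
  obtain ⟨f, g, hfg, h2⟩ := Finset.card_eq_two.1 h1
  have hf : f ∈ T.erase e := by simp [h2]
  have hg : g ∈ T.erase e := by simp [h2]
  exact ⟨f, g, hfg, Finset.ne_of_mem_erase hf, Finset.ne_of_mem_erase hg, by
    rw [← h2, Finset.insert_erase he]⟩

/-- `A` together with all triples of `H` meeting `A` at least twice. -/
def reach (H : Finset (Finset E)) (A : Finset E) : Finset E :=
  A ∪ A.offDiag.biUnion fun p => (H.filter fun T => p.1 ∈ T ∧ p.2 ∈ T).biUnion id

lemma IsSystem.card_pair_le (hH : IsSystem H N) {a b : E} (hab : a ≠ b) :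
    (H.filter fun T => a ∈ T ∧ b ∈ T).card ≤ 1 := by
  refine Finset.card_le_one.2 fun T hT T' hT' => ?_
  simp only [Finset.mem_filter] at hT hT'
  exact hH.linear T hT.1 T' hT'.1 a b hab hT.2.1 hT.2.2 hT'.2.1 hT'.2.2

lemma IsSystem.card_reach_le (hH : IsSystem H N) (A : Finset E) :
    (reach H A).card ≤ A.card + 3 * A.card ^ 2 := by
  refine (Finset.card_union_le _ _).trans (Nat.add_le_add_left ?_ _)
  refine (Finset.card_biUnion_le_card_mul _ _ 3 fun p hp => ?_).trans ?_
  · refine (Finset.card_biUnion_le_card_mul _ _ 3 fun T hT => ?_).trans ?_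
    · exact (hH.card_eq T (Finset.mem_filter.1 hT).1).le
    · have := hH.card_pair_le (Finset.mem_offDiag.1 hp).2.2
      omega
  · rw [Finset.offDiag_card, mul_comm, sq]
    exact Nat.mul_le_mul_left 3 (Nat.sub_le _ _)

lemma IsSystem.mem_reach (hH : IsSystem H N) (hT : T ∈ H) (hf : f ∈ T)
    (hTA : T ⊆ insert f A) : f ∈ reach H A := by
  obtain ⟨a, b, hab, haf, hbf, rfl⟩ := exists_eq_triple (hH.card_eq T hT) hf
  have ha : a ∈ A := Finset.mem_of_mem_insert_of_ne (hTA (by simp)) haf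
  have hb : b ∈ A := Finset.mem_of_mem_insert_of_ne (hTA (by simp)) hbf
  refine Finset.mem_union_right _ (Finset.mem_biUnion.2 ⟨(a, b), by simp [ha, hb, hab], ?_⟩)
  exact Finset.mem_biUnion.2 ⟨_, Finset.mem_filter.2 ⟨hT, by simp⟩, by simp⟩

lemma IsSystem.card_meet_le (hH : IsSystem H N) (e : E) (U : Finset E) :
    (H.filter fun T => e ∈ T ∧ ∃ u ∈ T, u ≠ e ∧ u ∈ U).card ≤ U.card := by
  calc _ ≤ ((U.erase e).biUnion fun u => H.filter fun T => e ∈ T ∧ u ∈ T).card := by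
        refine Finset.card_le_card fun T hT => ?_
        simp only [Finset.mem_filter] at hT
        obtain ⟨hT, he, u, huT, hue, huU⟩ := hT
        exact Finset.mem_biUnion.2 ⟨u, by simp [hue, huU], by simp [hT, he, huT]⟩
    _ ≤ (U.erase e).card * 1 := Finset.card_biUnion_le_card_mul _ _ 1 fun u hu =>
        hH.card_pair_le (Finset.ne_of_mem_erase hu).symm
    _ ≤ U.card := by rw [mul_one]; exact Finset.card_le_card (Finset.erase_subset _ _)

lemma not_subset_union_of_mem_erase (hH : IsSystem H N) (hT : T ∈ J) (he : e ∈ T)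
    (hF : ∀ u ∈ T, Free H J A u) : ∀ T' ∈ J.erase T, ¬ T' ⊆ A ∪ T := by
  intro T' hT' hs
  obtain ⟨hne, hT'J⟩ := Finset.mem_erase.1 hT'
  by_cases h : ∃ u ∈ T', u ∈ T
  · obtain ⟨u, huT', huT⟩ := h
    refine (hF u huT).not_subset T' hT'J fun v hv => ?_
    rcases Finset.mem_union.1 (hs hv) with hvA | hvT
    · exact Finset.mem_insert_of_mem hvA
    · by_cases huv : u = v
      · exact huv ▸ Finset.mem_insert_self _ _
      · exact absurd (hH.linear T' ((hF u huT).sub hT'J) T ((hF u huT).sub hT) u v huv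
          huT' hv huT hvT) hne
  · push Not at h
    refine (hF e he).not_subset' T' hT'J fun v hv => ?_
    exact (Finset.mem_union.1 (hs hv)).resolve_right (h v hv)

lemma Free.erase (hH : IsSystem H N) (hT : T ∈ J) (he : e ∈ T) (hF : ∀ u ∈ T, Free H J A u)
    (hAB : insert e A ⊆ B) (hf : f ∉ B) (hB : insert f B ⊆ A ∪ T) :
    Free H (J.erase T) B f := by
  refine ⟨(Finset.erase_subset _ _).trans (hF e he).sub, fun T' hT' hd => ?_, hf,
    fun T' hT' hs => not_subset_union_of_mem_erase hH hT he hF T' hT' (hs.trans hB)⟩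
  have hd' := Finset.disjoint_of_subset_right hAB hd
  refine Finset.mem_erase.2 ⟨?_, (hF e he).mem_of_disjoint T' hT'
    (Finset.disjoint_of_subset_right (Finset.subset_insert e A) hd')⟩
  rintro rfl
  exact Finset.disjoint_left.1 hd' he (Finset.mem_insert_self e A)

variable [Fintype E]

/-- Total weight of the sets containing `A`. -/
def part (lam zeta : ℝ) (J : Finset (Finset E)) (A : Finset E) : ℝ :=
  ∑ S with A ⊆ S, weight lam zeta J S

/-- Conditional probability of `e` given that `A` is present. -/
def marg (lam zeta : ℝ) (J : Finset (Finset E)) (A : Finset E) (e : E) : ℝ :=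
  part lam zeta J (insert e A) / part lam zeta J A

lemma part_nonneg (hl : 0 < lam) (hz1 : zeta ≤ 1) : 0 ≤ part lam zeta J A :=
  Finset.sum_nonneg fun _ _ => weight_nonneg hl hz1

lemma part_mono (hl : 0 < lam) (hz1 : zeta ≤ 1) (h : A ⊆ B) :
    part lam zeta J B ≤ part lam zeta J A := by
  refine Finset.sum_le_sum_of_subset_of_nonneg ?_ fun _ _ _ => weight_nonneg hl hz1
  intro S; simp only [Finset.mem_filter, Finset.mem_univ, true_and]; exact h.trans

lemma part_anti (hl : 0 < lam) (hz : 0 ≤ zeta) (hz1 : zeta ≤ 1) (h : K ⊆ J) :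
    part lam zeta J A ≤ part lam zeta K A :=
  Finset.sum_le_sum fun _ _ => weight_anti hl hz hz1 h

lemma part_pos (hl : 0 < lam) (hz1 : zeta ≤ 1) (h : ∀ T ∈ J, ¬ T ⊆ A) :
    0 < part lam zeta J A := by
  have h1 : weight lam zeta J A ≤ part lam zeta J A :=
    Finset.single_le_sum (f := fun S => weight lam zeta J S)
      (fun _ _ => weight_nonneg hl hz1) (by simp)
  refine lt_of_lt_of_le ?_ h1
  unfold weight
  rw [Finset.filter_false_of_mem h]
  simp [hl]

lemma part_insert (hT : T ∉ K) :
    part lam zeta (insert T K) A = part lam zeta K A - zeta * part lam zeta K (A ∪ T) := by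
  unfold part
  have h1 : ∑ S with A ∪ T ⊆ S, weight lam zeta K S
      = ∑ S with A ⊆ S, if T ⊆ S then weight lam zeta K S else 0 := by
    rw [← Finset.sum_filter, Finset.filter_filter]
    simp only [Finset.union_subset_iff]
  rw [h1, Finset.mul_sum, ← Finset.sum_sub_distrib]
  refine Finset.sum_congr rfl fun S _ => ?_
  rw [weight_insert hT]
  split_ifs <;> ring

lemma part_erase (hT : T ∈ J) (hTA : T ⊆ A) :
    part lam zeta J A = (1 - zeta) * part lam zeta (J.erase T) A := by
  conv_lhs => rw [← Finset.insert_erase hT]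
  rw [part_insert (Finset.notMem_erase T J), Finset.union_eq_left.2 hTA]
  ring

lemma part_split (hl : 0 < lam) (he : e ∉ A) :
    part lam zeta J A = part lam zeta J (insert e A)
      + lam⁻¹ * part lam zeta (J.filter (e ∉ ·)) (insert e A) := by
  unfold part
  rw [← Finset.sum_filter_add_sum_filter_not _ (fun S => e ∈ S), Finset.filter_filter,
    Finset.filter_filter, Finset.mul_sum]
  congr 1
  · refine Finset.sum_congr ?_ fun _ _ => rfl
    ext S; simp [Finset.insert_subset_iff, and_comm]
  · refine Finset.sum_nbij' (insert e) (Finset.erase · e) ?_ ?_ ?_ ?_ ?_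
    · intro S; simp only [Finset.mem_filter, Finset.mem_univ, true_and]
      rintro ⟨h, -⟩; exact Finset.insert_subset_insert e h
    · intro S; simp only [Finset.mem_filter, Finset.mem_univ, true_and]
      intro h
      exact ⟨Finset.subset_erase.2 ⟨(Finset.subset_insert e A).trans h, he⟩,
        Finset.notMem_erase e S⟩
    · intro S; simp only [Finset.mem_filter, Finset.mem_univ, true_and]
      rintro ⟨-, h⟩; exact Finset.erase_insert h
    · intro S; simp only [Finset.mem_filter, Finset.mem_univ, true_and]
      intro h; exact Finset.insert_erase (h (Finset.mem_insert_self e A))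
    · intro S; simp only [Finset.mem_filter, Finset.mem_univ, true_and]
      rintro ⟨-, h⟩
      unfold weight
      have h2 : (J.filter (e ∉ ·)).filter (· ⊆ insert e S) = J.filter (· ⊆ S) := by
        rw [Finset.filter_filter]
        refine Finset.filter_congr fun T _ => ?_
        constructor
        · rintro ⟨h3, h4⟩; exact (Finset.subset_insert_iff_of_notMem h3).1 h4
        · intro h3; exact ⟨fun h4 => h (h3 h4), h3.trans (Finset.subset_insert e S)⟩
      rw [h2, Finset.card_insert_of_notMem h, pow_succ]
      field_simp

lemma part_insert_le (hl : 0 < lam) (hz : 0 ≤ zeta) (hz1 : zeta ≤ 1) (he : e ∉ A) :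
    part lam zeta J (insert e A) ≤ lam * part lam zeta J A := by
  have h1 := part_split (zeta := zeta) (J := J) hl he
  have h2 := part_nonneg (J := J) (A := insert e A) hl hz1
  have h3 := part_anti (A := insert e A) hl hz hz1 (Finset.filter_subset (e ∉ ·) J)
  have h4 : lam * part lam zeta J A = lam * part lam zeta J (insert e A)
      + part lam zeta (J.filter (e ∉ ·)) (insert e A) := by
    rw [h1]; field_simp
  have := mul_nonneg hl.le h2
  linarith

lemma marg_nonneg (hl : 0 < lam) (hz1 : zeta ≤ 1) : 0 ≤ marg lam zeta J A e :=
  div_nonneg (part_nonneg hl hz1) (part_nonneg hl hz1)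

lemma marg_le (hl : 0 < lam) (hz : 0 ≤ zeta) (hz1 : zeta ≤ 1) (he : e ∉ A) :
    marg lam zeta J A e ≤ lam :=
  div_le_of_le_mul₀ (part_nonneg hl hz1) hl.le (part_insert_le hl hz hz1 he)

lemma part_div_insert_insert (hl : 0 < lam) (hz1 : zeta ≤ 1) (h : ∀ T ∈ K, ¬ T ⊆ insert f A) :
    part lam zeta K (insert g (insert f A)) / part lam zeta K A
      = marg lam zeta K A f * marg lam zeta K (insert f A) g := by
  have h1 : 0 < part lam zeta K (insert f A) := part_pos hl hz1 h
  unfold marg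
  field_simp

/-- Removing the triples at `e` one at a time: the effect of a single triple avoiding the exceptional
elements is determined by two unexceptional marginals. -/
lemma factor_good (hH : IsSystem H N) (hl : 0 < lam) (hz : 0 ≤ zeta) (hz1 : zeta ≤ 1)
    {x δ : ℝ} (hx : 0 ≤ x) (hxl : x ≤ lam) {m : ℕ}
    (ih : ∀ K A f, A.card ≤ m + 2 → Free H K A f → |marg lam zeta K A f - x| ≤ δ)
    (hA : A.card ≤ m) (hF : Free H J A e)
    (hK : K ⊆ J) (hJK : J.filter (e ∉ ·) ⊆ K) (hT : T ∈ J) (heT : e ∈ T) (hTK : T ∉ K)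
    (hgood : ¬ ∃ u ∈ T, u ≠ e ∧ u ∈ reach H (insert e A)) :
    |zeta * x ^ 2 - zeta * (part lam zeta K (insert e A ∪ T) / part lam zeta K (insert e A))|
      ≤ 2 * zeta * lam * δ := by
  push Not at hgood
  obtain ⟨f, g, hfg, hfe, hge, hTe⟩ := exists_eq_triple (hH.card_eq T (hF.sub hT)) heT
  have hfT : f ∈ T := by simp [hTe]
  have hgT : g ∈ T := by simp [hTe]
  have hfU := hgood f hfT hfe
  have hgU := hgood g hgT hge
  have hfA : f ∉ insert e A := fun h => hfU (Finset.mem_union_left _ h)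
  have hgA : g ∉ insert e A := fun h => hgU (Finset.mem_union_left _ h)
  have hdis : ∀ B, insert e A ⊆ B → ∀ T ∈ H, Disjoint T B → T ∈ K := by
    intro B hB T' hT' hd
    have h1 := Finset.disjoint_of_subset_right hB hd
    refine hJK (Finset.mem_filter.2 ⟨hF.mem_of_disjoint T' hT'
      (Finset.disjoint_of_subset_right (Finset.subset_insert e A) h1), ?_⟩)
    exact fun h => Finset.disjoint_left.1 h1 h (Finset.mem_insert_self e A)
  have hsub : ∀ u, u ∉ reach H (insert e A) → ∀ T' ∈ K, ¬ T' ⊆ insert u (insert e A) := by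
    intro u hu T' hT' h
    by_cases huT : u ∈ T'
    · exact hu (hH.mem_reach (hF.sub (hK hT')) huT h)
    · exact hF.not_subset T' (hK hT') ((Finset.subset_insert_iff_of_notMem huT).1 h)
  have hFf : Free H K (insert e A) f :=
    ⟨hK.trans hF.sub, hdis _ subset_rfl, hfA, hsub f hfU⟩
  have hFg : Free H K (insert f (insert e A)) g := by
    refine ⟨hK.trans hF.sub, hdis _ (Finset.subset_insert _ _), ?_, fun T' hT' h => ?_⟩
    · simp only [Finset.mem_insert, not_or] at hgA ⊢; exact ⟨hfg.symm, hgA⟩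
    · by_cases h1 : g ∈ T'
      · by_cases h2 : f ∈ T'
        · exact hTK (hH.linear T' (hF.sub (hK hT')) T (hF.sub hT) f g hfg h2 h1 hfT hgT ▸ hT')
        · rw [Finset.insert_comm] at h
          exact hsub g hgU T' hT' ((Finset.subset_insert_iff_of_notMem h2).1 h)
      · exact hsub f hfU T' hT' ((Finset.subset_insert_iff_of_notMem h1).1 h)
  have hc : (insert e A).card ≤ m + 1 := (Finset.card_insert_le _ _).trans (by omega)
  have h1 := ih K _ f (hc.trans (by omega)) hFf
  have h2 := ih K _ g ((Finset.card_insert_le _ _).trans (by omega)) hFg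
  have h3 : insert e A ∪ T = insert g (insert f (insert e A)) := by
    rw [hTe]; ext; simp only [Finset.mem_union, Finset.mem_insert, Finset.mem_singleton]; tauto
  rw [h3, part_div_insert_insert hl hz1 hFf.not_subset]
  set p := marg lam zeta K (insert e A) f
  set q := marg lam zeta K (insert f (insert e A)) g
  have hp0 : 0 ≤ p := marg_nonneg hl hz1
  have hpl : p ≤ lam := marg_le hl hz hz1 hfA
  have h4 : zeta * x ^ 2 - zeta * (p * q) = - (zeta * (p * (q - x) + x * (p - x))) := by ring
  rw [h4, abs_neg, abs_mul, abs_of_nonneg hz]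
  have h5 : |p * (q - x) + x * (p - x)| ≤ lam * δ + lam * δ := by
    refine (abs_add_le _ _).trans (add_le_add ?_ ?_)
    · rw [abs_mul, abs_of_nonneg hp0]
      exact mul_le_mul hpl h2 (abs_nonneg _) hl.le
    · rw [abs_mul, abs_of_nonneg hx]
      exact mul_le_mul hxl h1 (abs_nonneg _) hl.le
  calc _ ≤ zeta * (lam * δ + lam * δ) := mul_le_mul_of_nonneg_left h5 hz
    _ = _ := by ring

lemma factor_le (hl : 0 < lam) (hl1 : lam ≤ 1) (hz : 0 ≤ zeta) (hz1 : zeta ≤ 1)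
    {x : ℝ} (hx : 0 ≤ x) (hxl : x ≤ lam) (hT : ¬ T ⊆ A) :
    |zeta * x ^ 2 - zeta * (part lam zeta K (A ∪ T) / part lam zeta K A)| ≤ lam := by
  obtain ⟨f, hfT, hfA⟩ := Finset.not_subset.1 hT
  have h1 : part lam zeta K (A ∪ T) / part lam zeta K A ≤ lam := by
    refine le_trans ?_ (marg_le (J := K) hl hz hz1 hfA)
    refine div_le_div_of_nonneg_right (part_mono hl hz1 ?_) (part_nonneg hl hz1)
    exact Finset.insert_subset (Finset.mem_union_right _ hfT) Finset.subset_union_left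
  have h0 : 0 ≤ part lam zeta K (A ∪ T) / part lam zeta K A :=
    div_nonneg (part_nonneg hl hz1) (part_nonneg hl hz1)
  have h2 : x ^ 2 ≤ lam := by nlinarith
  rw [← mul_sub, abs_mul, abs_of_nonneg hz]
  have h3 : |x ^ 2 - part lam zeta K (A ∪ T) / part lam zeta K A| ≤ lam :=
    abs_le.2 ⟨by nlinarith, by linarith⟩
  calc _ ≤ 1 * lam := mul_le_mul hz1 h3 (abs_nonneg _) zero_le_one
    _ = lam := one_mul _

lemma ratio_sub_pow_le (hH : IsSystem H N) (hl : 0 < lam) (hl1 : lam ≤ 1)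
    (hz : 0 ≤ zeta) (hz1 : zeta ≤ 1)
    {x δ : ℝ} (hx : 0 ≤ x) (hxl : x ≤ lam) {m : ℕ}
    (ih : ∀ K A f, A.card ≤ m + 2 → Free H K A f → |marg lam zeta K A f - x| ≤ δ)
    (hA : A.card ≤ m) (hF : Free H J A e) (D : Finset (Finset E)) (hD : D ⊆ J.filter (e ∈ ·)) :
    |part lam zeta (J.filter (e ∉ ·) ∪ D) (insert e A)
        / part lam zeta (J.filter (e ∉ ·)) (insert e A) - (1 - zeta * x ^ 2) ^ D.card|
      ≤ ∑ T ∈ D, if ∃ u ∈ T, u ≠ e ∧ u ∈ reach H (insert e A) then lam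
          else 2 * zeta * lam * δ := by
  have hsub := Finset.filter_subset (e ∉ ·) J
  have h0 : 0 < part lam zeta (J.filter (e ∉ ·)) (insert e A) :=
    part_pos hl hz1 fun T hT => hF.not_subset T (hsub hT)
  have hx2 : x ^ 2 ≤ 1 := by nlinarith
  have hb0 : 0 ≤ 1 - zeta * x ^ 2 := by nlinarith [sq_nonneg x]
  have hb1 : 1 - zeta * x ^ 2 ≤ 1 := by nlinarith [sq_nonneg x]
  induction D using Finset.induction_on with
  | empty => simp [div_self h0.ne']
  | insert T D hTD ihD =>
    have hT := Finset.mem_filter.1 (hD (Finset.mem_insert_self T D))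
    have hD' := (Finset.subset_insert T D).trans hD
    specialize ihD hD'
    rw [Finset.sum_insert hTD, Finset.union_insert, Finset.card_insert_of_notMem hTD]
    set K := J.filter (e ∉ ·) ∪ D with hKdef
    have hTK : T ∉ K := by
      simp only [hKdef, Finset.mem_union, Finset.mem_filter, not_or]
      exact ⟨fun h => h.2 hT.2, hTD⟩
    have hKJ : K ⊆ J := Finset.union_subset hsub (hD'.trans (Finset.filter_subset _ _))
    have hKpos : 0 < part lam zeta K (insert e A) :=
      part_pos hl hz1 fun T hT => hF.not_subset T (hKJ hT)
    have herr : |zeta * x ^ 2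
        - zeta * (part lam zeta K (insert e A ∪ T) / part lam zeta K (insert e A))|
        ≤ if ∃ u ∈ T, u ≠ e ∧ u ∈ reach H (insert e A) then lam else 2 * zeta * lam * δ := by
      split_ifs with hbad
      · exact factor_le hl hl1 hz hz1 hx hxl (hF.not_subset T hT.1)
      · exact factor_good hH hl hz hz1 hx hxl ih hA hF hKJ Finset.subset_union_left hT.1 hT.2
          hTK hbad
    have hq0 : 0 ≤ part lam zeta K (insert e A ∪ T) / part lam zeta K (insert e A) :=
      div_nonneg (part_nonneg hl hz1) (part_nonneg hl hz1)
    have hq1 : part lam zeta K (insert e A ∪ T) / part lam zeta K (insert e A) ≤ 1 :=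
      div_le_one_of_le₀ (part_mono hl hz1 Finset.subset_union_left) hKpos.le
    have heq : part lam zeta (insert T K) (insert e A)
          / part lam zeta (J.filter (e ∉ ·)) (insert e A)
        = part lam zeta K (insert e A) / part lam zeta (J.filter (e ∉ ·)) (insert e A)
          * (1 - zeta * (part lam zeta K (insert e A ∪ T) / part lam zeta K (insert e A))) := by
      rw [part_insert hTK]; field_simp
    rw [heq]
    set q := part lam zeta K (insert e A ∪ T) / part lam zeta K (insert e A)
    set R := part lam zeta K (insert e A) / part lam zeta (J.filter (e ∉ ·)) (insert e A)
    set b := 1 - zeta * x ^ 2 with hb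
    have h1 : R * (1 - zeta * q) - b ^ (D.card + 1)
        = (R - b ^ D.card) * (1 - zeta * q) + b ^ D.card * (zeta * x ^ 2 - zeta * q) := by
      rw [hb]; ring
    rw [h1, add_comm (ite _ _ _)]
    refine (abs_add_le _ _).trans (add_le_add ?_ ?_)
    · rw [abs_mul]
      refine (mul_le_of_le_one_right (abs_nonneg _) ?_).trans ihD
      exact abs_le.2 ⟨by nlinarith, by nlinarith⟩
    · rw [abs_mul, abs_of_nonneg (pow_nonneg hb0 _)]
      exact (mul_le_of_le_one_left (abs_nonneg _) (pow_le_one₀ hb0 hb1)).trans herr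

/-- One step of the recursion for marginals. -/
lemma marg_step (hH : IsSystem H N) (hl : 0 < lam) (hl1 : lam ≤ 1)
    (hz : 0 ≤ zeta) (hz1 : zeta ≤ 1)
    {x δ : ℝ} (hx : 0 ≤ x) (hxl : x ≤ lam) (hδ : 0 ≤ δ) {m : ℕ}
    (ih : ∀ K A f, A.card ≤ m + 2 → Free H K A f → |marg lam zeta K A f - x| ≤ δ)
    (hA : A.card ≤ m) (hF : Free H J A e) :
    |marg lam zeta J A e - lam * (1 - zeta * x ^ 2) ^ N|
      ≤ lam * (N * (2 * zeta * lam * δ)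
        + 2 * (((m + 1) + 3 * (m + 1) ^ 2 : ℕ) * lam) + lam) := by
  set M : ℕ := (m + 1) + 3 * (m + 1) ^ 2
  have hsub := Finset.filter_subset (e ∉ ·) J
  have h0 : 0 < part lam zeta (J.filter (e ∉ ·)) (insert e A) :=
    part_pos hl hz1 fun T hT => hF.not_subset T (hsub hT)
  have hx2 : x ^ 2 ≤ lam := by nlinarith
  have hb0 : 0 ≤ 1 - zeta * x ^ 2 := by nlinarith [sq_nonneg x]
  have hb1 : 1 - zeta * x ^ 2 ≤ 1 := by nlinarith [sq_nonneg x]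
  have hbad : (H.filter fun T => e ∈ T ∧ ∃ u ∈ T, u ≠ e ∧ u ∈ reach H (insert e A)).card ≤ M := by
    have hc : (insert e A).card ≤ m + 1 := (Finset.card_insert_le _ _).trans (by omega)
    refine (hH.card_meet_le _ _).trans ((hH.card_reach_le _).trans ?_)
    exact Nat.add_le_add hc (Nat.mul_le_mul_left 3 (Nat.pow_le_pow_left hc 2))
  have h1 := ratio_sub_pow_le hH hl hl1 hz hz1 hx hxl ih hA hF _ subset_rfl
  rw [Finset.union_comm, Finset.filter_union_filter_not_eq] at h1
  set D := J.filter (e ∈ ·) with hDdef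
  have hDH : D ⊆ H.filter (e ∈ ·) := Finset.filter_subset_filter _ hF.sub
  have hDN : D.card ≤ N := (hH.regular e) ▸ Finset.card_le_card hDH
  have hND : N ≤ D.card + M := by
    have h2 : H.filter (e ∈ ·) ⊆ D ∪
        H.filter fun T => e ∈ T ∧ ∃ u ∈ T, u ≠ e ∧ u ∈ reach H (insert e A) := by
      intro T hT
      rw [Finset.mem_filter] at hT
      by_cases hTJ : T ∈ J
      · exact Finset.mem_union_left _ (Finset.mem_filter.2 ⟨hTJ, hT.2⟩)
      · have h3 := mt (hF.mem_of_disjoint T hT.1) hTJ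
        obtain ⟨u, huT, huA⟩ := Finset.not_disjoint_iff.1 h3
        refine Finset.mem_union_right _ (Finset.mem_filter.2 ⟨hT.1, hT.2, u, huT, ?_, ?_⟩)
        · rintro rfl; exact hF.notMem huA
        · exact Finset.mem_union_left _ (Finset.mem_insert_of_mem huA)
    have h3 := (Finset.card_le_card h2).trans (Finset.card_union_le _ _)
    rw [hH.regular e] at h3
    omega
  have h2 : ∑ T ∈ D, (if ∃ u ∈ T, u ≠ e ∧ u ∈ reach H (insert e A) then lam
      else 2 * zeta * lam * δ) ≤ M * lam + N * (2 * zeta * lam * δ) := by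
    rw [Finset.sum_ite, Finset.sum_const, Finset.sum_const, nsmul_eq_mul, nsmul_eq_mul]
    refine add_le_add (mul_le_mul_of_nonneg_right ?_ hl.le)
      (mul_le_mul_of_nonneg_right ?_ (by positivity))
    · refine Nat.cast_le.2 (le_trans (Finset.card_le_card ?_) hbad)
      intro T hT
      rw [Finset.mem_filter] at hT
      have := Finset.mem_filter.1 (hDH hT.1)
      exact Finset.mem_filter.2 ⟨this.1, this.2, hT.2⟩
    · exact Nat.cast_le.2 ((Finset.card_filter_le _ _).trans hDN)
  have h3 : |(1 - zeta * x ^ 2) ^ D.card - (1 - zeta * x ^ 2) ^ N| ≤ M * lam := by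
    obtain ⟨k, hk⟩ := Nat.exists_eq_add_of_le hDN
    have hkM : (k : ℝ) ≤ M := Nat.cast_le.2 (by omega)
    have h4 := one_add_mul_le_pow (a := -(zeta * x ^ 2)) (by linarith) k
    rw [← sub_eq_add_neg] at h4
    have h5 : (1 - zeta * x ^ 2) ^ k ≤ 1 := pow_le_one₀ hb0 hb1
    have h6 : 1 - (1 - zeta * x ^ 2) ^ k ≤ M * lam := by
      have : k * (zeta * x ^ 2) ≤ M * lam :=
        mul_le_mul hkM (by nlinarith [sq_nonneg x]) (by positivity) (by positivity)
      linarith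
    rw [hk, pow_add, ← mul_one_sub, abs_mul, abs_of_nonneg (pow_nonneg hb0 _),
      abs_of_nonneg (sub_nonneg.2 h5)]
    exact (mul_le_of_le_one_left (sub_nonneg.2 h5) (pow_le_one₀ hb0 hb1)).trans h6
  have h4 := part_split (zeta := zeta) (J := J) hl hF.notMem
  have hR0 : 0 ≤ part lam zeta J (insert e A)
      / part lam zeta (J.filter (e ∉ ·)) (insert e A) := div_nonneg (part_nonneg hl hz1) h0.le
  have hR1 : part lam zeta J (insert e A)
      / part lam zeta (J.filter (e ∉ ·)) (insert e A) ≤ 1 :=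
    div_le_one_of_le₀ (part_anti hl hz hz1 hsub) h0.le
  have h5 : marg lam zeta J A e = lam * (part lam zeta J (insert e A)
      / part lam zeta (J.filter (e ∉ ·)) (insert e A)) / (1 + lam * (part lam zeta J (insert e A)
      / part lam zeta (J.filter (e ∉ ·)) (insert e A))) := by
    unfold marg
    rw [h4]
    have := part_nonneg (lam := lam) (zeta := zeta) (J := J) (A := insert e A) hl hz1
    field_simp
    ring
  rw [h5]
  set R := part lam zeta J (insert e A) / part lam zeta (J.filter (e ∉ ·)) (insert e A)
  have h6 : |lam * R / (1 + lam * R) - lam * R| ≤ lam * lam := by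
    have h7 : 0 < 1 + lam * R := by positivity
    have h8 : lam * R / (1 + lam * R) - lam * R = -((lam * R) * (lam * R) / (1 + lam * R)) := by
      field_simp; ring
    have h9 : lam * R ≤ lam := mul_le_of_le_one_right hl.le hR1
    rw [h8, abs_neg, abs_of_nonneg (by positivity), div_le_iff₀ h7]
    have h10 : (lam * R) * (lam * R) ≤ lam * lam := mul_le_mul h9 h9 (by positivity) hl.le
    have : 0 ≤ lam * lam * (lam * R) := by positivity
    linarith
  have h7 : |lam * R - lam * (1 - zeta * x ^ 2) ^ N|
      ≤ lam * (N * (2 * zeta * lam * δ) + 2 * (M * lam)) := by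
    rw [← mul_sub, abs_mul, abs_of_pos hl]
    refine mul_le_mul_of_nonneg_left ?_ hl.le
    have := abs_sub_le R ((1 - zeta * x ^ 2) ^ D.card) ((1 - zeta * x ^ 2) ^ N)
    linarith
  have h8 := abs_sub_le (lam * R / (1 + lam * R)) (lam * R) (lam * (1 - zeta * x ^ 2) ^ N)
  linarith

lemma part_union_triple (hH : IsSystem H N) (hl : 0 < lam) (hz1 : zeta ≤ 1)
    (hTJ : T ∈ J) (hF : ∀ u ∈ T, Free H J A u) (hT : T = {e, f, g}) :
    part lam zeta J (A ∪ T) / part lam zeta J A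
      = (1 - zeta) * (marg lam zeta J A e * (marg lam zeta (J.erase T) (insert e A) f
          * marg lam zeta (J.erase T) (insert f (insert e A)) g))
        / (1 - zeta * (marg lam zeta (J.erase T) (insert e A) f
          * marg lam zeta (J.erase T) (insert f (insert e A)) g)) := by
  have he : e ∈ T := by simp [hT]
  have hns := not_subset_union_of_mem_erase hH hTJ he hF
  have hun : A ∪ T = insert g (insert f (insert e A)) := by
    rw [hT]; ext; simp only [Finset.mem_union, Finset.mem_insert, Finset.mem_singleton]; tauto
  have hun' : insert e A ∪ T = insert g (insert f (insert e A)) := by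
    rw [← hun, Finset.insert_union, Finset.insert_eq_self]; exact Finset.mem_union_right _ he
  have h1 : 0 < part lam zeta J A := part_pos hl hz1 (hF e he).not_subset'
  have h2 : 0 < part lam zeta J (insert e A) := part_pos hl hz1 (hF e he).not_subset
  have h3 : 0 < part lam zeta (J.erase T) (insert e A) :=
    part_pos hl hz1 fun T' hT' => (hF e he).not_subset T' (Finset.mem_of_mem_erase hT')
  rw [← part_div_insert_insert hl hz1 fun T' hT' hs => hns T' hT' (hs.trans (by
    rw [hun]; exact Finset.subset_insert _ _))]
  have h4 : part lam zeta J (insert e A) = part lam zeta (J.erase T) (insert e A)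
      - zeta * part lam zeta (J.erase T) (insert g (insert f (insert e A))) := by
    conv_lhs => rw [← Finset.insert_erase hTJ]
    rw [part_insert (Finset.notMem_erase T J), hun']
  rw [part_erase hTJ Finset.subset_union_right, hun]
  unfold marg
  rw [h4] at h2 ⊢
  have h5 : part lam zeta (J.erase T) (insert e A)
      - zeta * part lam zeta (J.erase T) (insert g (insert f (insert e A))) ≠ 0 := h2.ne'
  have h6 : 1 - zeta * (part lam zeta (J.erase T) (insert g (insert f (insert e A)))
      / part lam zeta (J.erase T) (insert e A)) ≠ 0 := by
    intro h; apply h5; field_simp at h; linarith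
  field_simp

end TripleSystem

section Asymptotics

open TripleSystem

variable {E : ℕ → Type} [∀ n, Fintype (E n)] [∀ n, DecidableEq (E n)]
  {H : ∀ n, Finset (Finset (E n))} {lam : ℕ → ℝ} {c d zeta : ℝ}

lemma tendsto_sqrt_natCast : Tendsto (fun n : ℕ => Real.sqrt n) atTop atTop :=
  Real.tendsto_sqrt_atTop.comp tendsto_natCast_atTop_atTop

lemma tendsto_lam_zero (hlc : Tendsto (fun n : ℕ => Real.sqrt n * lam n) atTop (nhds c)) :
    Tendsto lam atTop (nhds 0) := by
  have h := hlc.mul (tendsto_inv_atTop_zero.comp tendsto_sqrt_natCast)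
  rw [mul_zero] at h
  refine h.congr' ?_
  filter_upwards [eventually_gt_atTop 0] with n hn
  have : 0 < Real.sqrt n := Real.sqrt_pos.2 (Nat.cast_pos.2 hn)
  simp only [Function.comp_apply]
  field_simp

lemma tendsto_sub_two_div : Tendsto (fun n : ℕ => ((n - 2 : ℕ) : ℝ) / n) atTop (nhds 1) := by
  have h : Tendsto (fun n : ℕ => 1 - 2 / (n : ℝ)) atTop (nhds (1 - 0)) :=
    tendsto_const_nhds.sub (tendsto_const_div_atTop_nhds_zero_nat 2)
  rw [sub_zero] at h
  refine h.congr' ?_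
  filter_upwards [eventually_ge_atTop 2] with n hn
  have : (n : ℝ) ≠ 0 := Nat.cast_ne_zero.2 (by omega)
  rw [Nat.cast_sub hn]
  field_simp
  simp

lemma tendsto_one_add_div_pow_sub_two (t : ℝ) :
    Tendsto (fun n : ℕ => (1 + t / n) ^ (n - 2)) atTop (nhds (Real.exp t)) := by
  have h1 : Tendsto (fun n : ℕ => 1 + t / (n : ℝ)) atTop (nhds (1 + 0)) :=
    tendsto_const_nhds.add (tendsto_const_div_atTop_nhds_zero_nat t)
  rw [add_zero] at h1
  have h2 := (Real.tendsto_one_add_div_pow_exp t).div (h1.pow 2) (by norm_num)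
  rw [one_pow, div_one] at h2
  refine h2.congr' ?_
  filter_upwards [eventually_ge_atTop 2, h1.eventually_ne one_ne_zero] with n hn hne
  simp only [Pi.div_apply]
  rw [div_eq_iff (pow_ne_zero 2 hne), ← pow_add, Nat.sub_add_cancel hn]

/-- The error in one step of the recursion, rescaled by `√n`. -/
lemma tendsto_step_error (hlc : Tendsto (fun n : ℕ => Real.sqrt n * lam n) atTop (nhds c))
    (hd : d = c * Real.exp (-(zeta * d ^ 2))) (δ M : ℝ) :
    Tendsto (fun n : ℕ => Real.sqrt n * (lam n * ((n - 2 : ℕ) * (2 * zeta * lam n * (δ / Real.sqrt n))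
        + 2 * (M * lam n) + lam n))
        + |Real.sqrt n * (lam n * (1 - zeta * (d / Real.sqrt n) ^ 2) ^ (n - 2)) - d|) atTop
      (nhds (2 * zeta * c ^ 2 * δ)) := by
  have hl0 := tendsto_lam_zero hlc
  have h1 := ((hlc.pow 2).mul tendsto_sub_two_div).const_mul (2 * zeta * δ)
  have h2 := (hlc.mul hl0).const_mul (2 * M + 1)
  have h3 := ((hlc.mul (tendsto_one_add_div_pow_sub_two (-(zeta * d ^ 2)))).sub_const d).abs
  rw [← hd, sub_self, abs_zero] at h3
  have h4 := (h1.add h2).add h3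
  have h5 : 2 * zeta * δ * (c ^ 2 * 1) + (2 * M + 1) * (c * 0) + 0 = 2 * zeta * c ^ 2 * δ := by ring
  rw [h5] at h4
  refine h4.congr' ?_
  filter_upwards [eventually_gt_atTop 0] with n hn
  have hs : 0 < Real.sqrt n := Real.sqrt_pos.2 (Nat.cast_pos.2 hn)
  have hsq : Real.sqrt n ^ 2 = n := Real.sq_sqrt (Nat.cast_nonneg n)
  have h6 : (1 + -(zeta * d ^ 2) / (n : ℝ)) = 1 - zeta * (d / Real.sqrt n) ^ 2 := by
    rw [div_pow, hsq]; ring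
  rw [h6]
  refine congrArg₂ (· + ·) ?_ (by rw [mul_assoc])
  rw [← hsq]
  simp only [Real.sqrt_sq hs.le]
  field_simp
  ring

lemma marg_recursion (hH : ∀ n, IsSystem (H n) (n - 2)) (hlam : ∀ n, 0 < lam n)
    (hlc : Tendsto (fun n : ℕ => Real.sqrt n * lam n) atTop (nhds c))
    (hz : 0 < zeta) (hz1 : zeta ≤ 1) (hd0 : 0 < d) (hdc : d < c)
    (hd : d = c * Real.exp (-(zeta * d ^ 2))) (l : ℕ) :
    ∀ m : ℕ, ∀ δ : ℝ, (2 * zeta * c ^ 2) ^ l * c < δ → ∀ᶠ n : ℕ in atTop,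
      ∀ J A e, A.card ≤ m → Free (H n) J A e →
        |marg (lam n) zeta J A e - d / Real.sqrt n| ≤ δ / Real.sqrt n := by
  have hc : 0 < c := hd0.trans hdc
  induction l with
  | zero =>
    intro m δ hδ
    rw [pow_zero, one_mul] at hδ
    filter_upwards [hlc.eventually_lt_const hδ, eventually_gt_atTop 0] with n h1 hn J A e _ hF
    have hs : 0 < Real.sqrt n := Real.sqrt_pos.2 (Nat.cast_pos.2 hn)
    have h2 := marg_nonneg (J := J) (A := A) (e := e) (hlam n) hz1
    have h3 := marg_le (J := J) (hlam n) hz.le hz1 hF.notMem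
    have h4 : lam n ≤ δ / Real.sqrt n := by rw [le_div_iff₀ hs, mul_comm]; exact h1.le
    have h5 : d / Real.sqrt n ≤ δ / Real.sqrt n :=
      div_le_div_of_nonneg_right (hdc.trans hδ).le hs.le
    have h6 : 0 ≤ d / Real.sqrt n := by positivity
    exact abs_le.2 ⟨by linarith, by linarith⟩
  | succ l ih =>
    intro m δ hδ
    set κ := 2 * zeta * c ^ 2 with hκdef
    have hκ : 0 < κ := by positivity
    obtain ⟨δ₀, h1, h2⟩ : ∃ δ₀, κ ^ l * c < δ₀ ∧ δ₀ < δ / κ := by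
      refine exists_between ?_
      rw [lt_div_iff₀ hκ]
      calc _ = κ ^ (l + 1) * c := by ring
        _ < δ := hδ
    have hδ₀ : 0 < δ₀ := lt_trans (by positivity) h1
    have h3 : κ * δ₀ < δ := by rw [mul_comm]; exact (lt_div_iff₀ hκ).1 h2
    set M : ℕ := (m + 1) + 3 * (m + 1) ^ 2 with hM
    filter_upwards [ih (m + 2) δ₀ h1, (tendsto_step_error hlc hd δ₀ M).eventually_lt_const h3,
      eventually_gt_atTop 0, hlc.eventually_const_lt hdc,
      (tendsto_lam_zero hlc).eventually_lt_const one_pos] with n hih herr hn hdl hl1 J A e hA hF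
    have hs : 0 < Real.sqrt n := Real.sqrt_pos.2 (Nat.cast_pos.2 hn)
    have hx : d / Real.sqrt n ≤ lam n := by rw [div_le_iff₀ hs, mul_comm]; exact hdl.le
    have h4 := marg_step (hH n) (hlam n) hl1.le hz.le hz1 (x := d / Real.sqrt n) (by positivity) hx
      (δ := δ₀ / Real.sqrt n) (by positivity) (fun K A f hA hF => hih K A f hA hF) hA hF
    rw [← hM] at h4
    set t := lam n * (1 - zeta * (d / Real.sqrt n) ^ 2) ^ (n - 2)
    have h5 : |t - d / Real.sqrt n| = |Real.sqrt n * t - d| / Real.sqrt n := by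
      rw [← abs_of_pos hs, ← abs_div, abs_of_pos hs]
      congr 1
      field_simp
    have h6 := abs_sub_le (marg (lam n) zeta J A e) t (d / Real.sqrt n)
    rw [h5] at h6
    refine h6.trans ?_
    rw [le_div_iff₀ hs, add_mul, div_mul_cancel₀ _ hs.ne']
    have h7 := mul_le_mul_of_nonneg_right h4 hs.le
    rw [mul_comm _ (Real.sqrt n)] at h7
    rw [mul_comm _ (Real.sqrt n)] at h7 ⊢
    linarith

/-- All unexceptional conditional marginals are asymptotic to `d / √n`. -/
lemma eventually_marg (hH : ∀ n, IsSystem (H n) (n - 2)) (hlam : ∀ n, 0 < lam n)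
    (hlc : Tendsto (fun n : ℕ => Real.sqrt n * lam n) atTop (nhds c))
    (hz : 0 < zeta) (hz1 : zeta ≤ 1) (hd0 : 0 < d) (hdc : d < c)
    (hd : d = c * Real.exp (-(zeta * d ^ 2))) (hκ : 2 * zeta * c ^ 2 < 1)
    (m : ℕ) {δ : ℝ} (hδ : 0 < δ) :
    ∀ᶠ n : ℕ in atTop, ∀ J A e, A.card ≤ m → Free (H n) J A e →
      |Real.sqrt n * marg (lam n) zeta J A e - d| ≤ δ := by
  have h1 : Tendsto (fun l : ℕ => (2 * zeta * c ^ 2) ^ l * c) atTop (nhds (0 * c)) :=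
    (tendsto_pow_atTop_nhds_zero_of_lt_one (by positivity) hκ).mul_const c
  rw [zero_mul] at h1
  obtain ⟨l, hl⟩ := (h1.eventually_lt_const hδ).exists
  filter_upwards [marg_recursion hH hlam hlc hz hz1 hd0 hdc hd l m δ hl,
    eventually_gt_atTop 0] with n h hn J A e hA hF
  have hs : 0 < Real.sqrt n := Real.sqrt_pos.2 (Nat.cast_pos.2 hn)
  have h2 := h J A e hA hF
  have h3 : Real.sqrt n * marg (lam n) zeta J A e - d
      = Real.sqrt n * (marg (lam n) zeta J A e - d / Real.sqrt n) := by field_simp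
  rw [h3, abs_mul, abs_of_pos hs, mul_comm]
  exact (le_div_iff₀ hs).1 h2

/-- The conditional probability of an unexceptional triple. -/
lemma eventually_triple (hH : ∀ n, IsSystem (H n) (n - 2)) (hlam : ∀ n, 0 < lam n)
    (hlc : Tendsto (fun n : ℕ => Real.sqrt n * lam n) atTop (nhds c))
    (hz : 0 < zeta) (hz1 : zeta ≤ 1) (hd0 : 0 < d) (hdc : d < c)
    (hd : d = c * Real.exp (-(zeta * d ^ 2))) (hκ : 2 * zeta * c ^ 2 < 1)
    (m : ℕ) {δ : ℝ} (hδ : 0 < δ) :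
    ∀ᶠ n : ℕ in atTop, ∀ J A, ∀ T ∈ J, A.card ≤ m → (∀ u ∈ T, Free (H n) J A u) → T ∈ H n →
      |Real.sqrt n ^ 3 * (part (lam n) zeta J (A ∪ T) / part (lam n) zeta J A)
        - (1 - zeta) * d ^ 3| ≤ δ := by
  have hcont : ContinuousAt (fun p : ℝ × ℝ × ℝ × ℝ =>
      (1 - zeta) * (p.1 * (p.2.1 * p.2.2.1)) / (1 - zeta * p.2.2.2)) (d, d, d, 0) := by
    refine ContinuousAt.div (by fun_prop) (by fun_prop) (by simp)
  obtain ⟨δ₁, hδ₁, h1⟩ := Metric.continuousAt_iff.1 hcont δ hδ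
  have hm := eventually_marg hH hlam hlc hz hz1 hd0 hdc hd hκ (m + 2) (half_pos hδ₁)
  filter_upwards [hm, (tendsto_lam_zero hlc).eventually_lt_const one_pos,
    (tendsto_lam_zero hlc).eventually_lt_const hδ₁] with n hn hl1 hl2 J A T hTJ hA hF hTH
  obtain ⟨e, f, g, hef, heg, hfg, hT⟩ := Finset.card_eq_three.1 ((hH n).card_eq T hTH)
  have he : e ∈ T := by simp [hT]
  have hf : f ∈ T := by simp [hT]
  have hg : g ∈ T := by simp [hT]
  have hAT : A ⊆ A ∪ T := Finset.subset_union_left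
  have hTA : T ⊆ A ∪ T := Finset.subset_union_right
  have hFf : Free (H n) (J.erase T) (insert e A) f := by
    refine Free.erase (hH n) hTJ he hF subset_rfl ?_ ?_
    · simp [hef.symm, (hF f hf).notMem]
    · exact Finset.insert_subset (hTA hf) (Finset.insert_subset (hTA he) hAT)
  have hFg : Free (H n) (J.erase T) (insert f (insert e A)) g := by
    refine Free.erase (hH n) hTJ he hF (Finset.subset_insert _ _) ?_ ?_
    · simp [heg.symm, hfg.symm, (hF g hg).notMem]
    · exact Finset.insert_subset (hTA hg) (Finset.insert_subset (hTA hf)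
        (Finset.insert_subset (hTA he) hAT))
  have hc : (insert e A).card ≤ m + 1 := (Finset.card_insert_le _ _).trans (by omega)
  have h2 := hn J A e (by omega) (hF e he)
  have h3 := hn _ _ f (by omega) hFf
  have h4 := hn _ _ g ((Finset.card_insert_le _ _).trans (by omega)) hFg
  rw [part_union_triple (hH n) (hlam n) hz1 hTJ hF hT]
  set p := marg (lam n) zeta J A e
  set q := marg (lam n) zeta (J.erase T) (insert e A) f with hq
  set r := marg (lam n) zeta (J.erase T) (insert f (insert e A)) g with hr
  have hq0 : 0 ≤ q := marg_nonneg (hlam n) hz1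
  have hr0 : 0 ≤ r := marg_nonneg (hlam n) hz1
  have hql : q ≤ lam n := marg_le (hlam n) hz.le hz1 hFf.notMem
  have hrl : r ≤ lam n := marg_le (hlam n) hz.le hz1 hFg.notMem
  have hqr : q * r < δ₁ := by nlinarith [hlam n]
  have hlt : δ₁ / 2 < δ₁ := half_lt_self hδ₁
  have h5 := h1 (x := (Real.sqrt n * p, Real.sqrt n * q, Real.sqrt n * r, q * r)) (by
    simp only [Prod.dist_eq, Real.dist_eq, max_lt_iff]
    refine ⟨h2.trans_lt hlt, h3.trans_lt hlt, h4.trans_lt hlt, ?_⟩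
    rwa [sub_zero, abs_of_nonneg (mul_nonneg hq0 hr0)])
  rw [Real.dist_eq] at h5
  refine le_of_eq_of_le ?_ h5.le
  congr 1
  simp only [mul_zero, sub_zero, div_one]
  ring

end Asymptotics

section Counting

variable {n : ℕ} {lam zeta : ℝ}

lemma gibbsWeight_nonneg (hl : 0 < lam) (hz1 : zeta ≤ 1) (G : SimpleGraph (Fin n)) :
    0 ≤ gibbsWeight lam zeta G :=
  mul_nonneg (pow_nonneg hl.le _) (pow_nonneg (sub_nonneg.2 hz1) _)

lemma Zfun_ne_zero (hl : 0 < lam) (hz1 : zeta ≤ 1) : Zfun n lam zeta ≠ 0 := by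
  refine (Finset.sum_pos' (fun G _ => gibbsWeight_nonneg hl hz1 G)
    ⟨⊥, Finset.mem_univ _, ?_⟩).ne'
  have h : triCount (⊥ : SimpleGraph (Fin n)) = 0 := by
    unfold triCount
    rw [Nat.card_eq_zero]
    refine Or.inl ⟨fun s => SimpleGraph.cliqueFree_bot (by norm_num) s.1 s.2⟩
  rw [gibbsWeight, h, pow_zero, mul_one]
  positivity

lemma gibbsExp_nonneg (hl : 0 < lam) (hz1 : zeta ≤ 1) {f : SimpleGraph (Fin n) → ℝ}
    (h : ∀ G, 0 ≤ f G) : 0 ≤ gibbsExp n lam zeta f :=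
  div_nonneg (Finset.sum_nonneg fun G _ => mul_nonneg (h G) (gibbsWeight_nonneg hl hz1 G))
    (Finset.sum_nonneg fun G _ => gibbsWeight_nonneg hl hz1 G)

lemma gibbsExp_add_mul (f g : SimpleGraph (Fin n) → ℝ) (a : ℝ) :
    gibbsExp n lam zeta (fun G => f G + a * g G)
      = gibbsExp n lam zeta f + a * gibbsExp n lam zeta g := by
  unfold gibbsExp
  rw [← mul_div_assoc, ← add_div, Finset.mul_sum, ← Finset.sum_add_distrib]
  congr 1
  exact Finset.sum_congr rfl fun G _ => by ring

lemma gibbsExp_mono (hl : 0 < lam) (hz1 : zeta ≤ 1) {f g : SimpleGraph (Fin n) → ℝ}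
    (h : ∀ G, f G ≤ g G) : gibbsExp n lam zeta f ≤ gibbsExp n lam zeta g :=
  div_le_div_of_nonneg_right
    (Finset.sum_le_sum fun G _ => mul_le_mul_of_nonneg_right (h G) (gibbsWeight_nonneg hl hz1 G))
    (Finset.sum_nonneg fun G _ => gibbsWeight_nonneg hl hz1 G)

lemma gibbsExp_const (hZ : Zfun n lam zeta ≠ 0) (a : ℝ) :
    gibbsExp n lam zeta (fun _ => a) = a := by
  unfold gibbsExp
  rw [← Finset.mul_sum]
  exact mul_div_cancel_right₀ a hZ

lemma gibbsProb_eq_gibbsExp (A : Set (SimpleGraph (Fin n))) :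
    gibbsProb n lam zeta A = gibbsExp n lam zeta (A.indicator fun _ => 1) := by
  unfold gibbsProb gibbsExp
  congr 1
  exact Finset.sum_congr rfl fun G _ => by by_cases h : G ∈ A <;> simp [h]

lemma gibbsProb_mono (hl : 0 < lam) (hz1 : zeta ≤ 1) {A B : Set (SimpleGraph (Fin n))}
    (h : A ⊆ B) : gibbsProb n lam zeta A ≤ gibbsProb n lam zeta B := by
  rw [gibbsProb_eq_gibbsExp, gibbsProb_eq_gibbsExp]
  exact gibbsExp_mono hl hz1 fun G => Set.indicator_le_indicator_of_subset h (fun _ => zero_le_one) G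

lemma gibbsProb_le_one (hl : 0 < lam) (hz1 : zeta ≤ 1) (hZ : Zfun n lam zeta ≠ 0)
    (A : Set (SimpleGraph (Fin n))) : gibbsProb n lam zeta A ≤ 1 := by
  rw [gibbsProb_eq_gibbsExp]
  refine le_of_le_of_eq (gibbsExp_mono hl hz1 fun G => ?_) (gibbsExp_const hZ 1)
  exact Set.indicator_le_self' (by simp) G

lemma le_gibbsProb_inter (hl : 0 < lam) (hz1 : zeta ≤ 1) (hZ : Zfun n lam zeta ≠ 0)
    (A B : Set (SimpleGraph (Fin n))) :
    gibbsProb n lam zeta A + gibbsProb n lam zeta B - 1 ≤ gibbsProb n lam zeta (A ∩ B) := by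
  have h := gibbsExp_mono hl hz1 (n := n)
    (f := fun G => A.indicator (fun _ => 1) G + 1 * B.indicator (fun _ => 1) G)
    (g := fun G => (A ∩ B).indicator (fun _ => 1) G + 1 * 1) fun G => by
      by_cases hA : G ∈ A <;> by_cases hB : G ∈ B <;> simp [hA, hB]
  rw [gibbsExp_add_mul, gibbsExp_add_mul _ (fun _ => (1 : ℝ)), gibbsExp_const hZ,
    ← gibbsProb_eq_gibbsExp, ← gibbsProb_eq_gibbsExp, ← gibbsProb_eq_gibbsExp] at h
  linarith

lemma gibbsProb_chebyshev (hl : 0 < lam) (hz1 : zeta ≤ 1) (hZ : Zfun n lam zeta ≠ 0)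
    (Y : SimpleGraph (Fin n) → ℝ) {t : ℝ} (ht : 0 < t) :
    1 - (gibbsExp n lam zeta (fun G => Y G ^ 2) - gibbsExp n lam zeta Y ^ 2) / t ^ 2
      ≤ gibbsProb n lam zeta {G | |Y G - gibbsExp n lam zeta Y| ≤ t} := by
  set a := gibbsExp n lam zeta Y with ha
  have h1 : gibbsExp n lam zeta (fun G => ((1 - a ^ 2 / t ^ 2) + (2 * a / t ^ 2) * Y G)
      + (-(1 / t ^ 2)) * Y G ^ 2)
      = 1 - (gibbsExp n lam zeta (fun G => Y G ^ 2) - a ^ 2) / t ^ 2 := by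
    rw [gibbsExp_add_mul, gibbsExp_add_mul (fun _ => 1 - a ^ 2 / t ^ 2), gibbsExp_const hZ, ← ha]
    ring
  rw [← h1, gibbsProb_eq_gibbsExp]
  refine gibbsExp_mono hl hz1 fun G => ?_
  rw [Set.indicator_apply]
  have h2 : ((1 - a ^ 2 / t ^ 2) + (2 * a / t ^ 2) * Y G) + (-(1 / t ^ 2)) * Y G ^ 2
      = 1 - (Y G - a) ^ 2 / t ^ 2 := by ring
  rw [h2]
  split_ifs with h
  · have : 0 ≤ (Y G - a) ^ 2 / t ^ 2 := by positivity
    linarith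
  · have h3 : t < |Y G - a| := not_le.1 h
    rw [sub_nonpos, one_le_div (by positivity), ← sq_abs (Y G - a)]
    exact pow_le_pow_left₀ ht.le h3.le 2

open TripleSystem

variable {E : Type} [Fintype E] [DecidableEq E] {H : Finset (Finset E)}

lemma Zfun_eq_part (φ : SimpleGraph (Fin n) ≃ Finset E)
    (hφ : ∀ G, gibbsWeight lam zeta G = weight lam zeta H (φ G)) :
    Zfun n lam zeta = part lam zeta H ∅ := by
  unfold Zfun part
  rw [← Equiv.sum_comp φ.symm]
  simp [hφ]

/-- Transport of expectations along an encoding of graphs as sets. -/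
lemma gibbsExp_sum_indicator (φ : SimpleGraph (Fin n) ≃ Finset E)
    (hφ : ∀ G, gibbsWeight lam zeta G = weight lam zeta H (φ G)) {ι : Type*} (F : Finset ι)
    (b : ι → Finset E) :
    gibbsExp n lam zeta (fun G => ∑ i ∈ F, if b i ⊆ φ G then 1 else 0)
      = ∑ i ∈ F, part lam zeta H (b i) / part lam zeta H ∅ := by
  unfold gibbsExp
  rw [Zfun_eq_part φ hφ, ← Finset.sum_div]
  congr 1
  simp_rw [Finset.sum_mul, ite_mul, one_mul, zero_mul, hφ]
  rw [Finset.sum_comm]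
  refine Finset.sum_congr rfl fun i _ => ?_
  rw [Equiv.sum_comp φ (fun S => if b i ⊆ S then weight lam zeta H S else 0),
    ← Finset.sum_filter]
  rfl

end Counting

section Concentration

open TripleSystem

variable {E : ℕ → Type} [∀ n, Fintype (E n)] [∀ n, DecidableEq (E n)]
  {H : ∀ n, Finset (Finset (E n))} {lam : ℕ → ℝ} {zeta : ℝ}

/-- First and second moment asymptotics for the number of members of `F` that are contained in the
random set, from first-order asymptotics of their conditional probabilities. -/
lemma count_concentration
    (hlam : ∀ n, 0 < lam n) (hz1 : zeta ≤ 1)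
    (φ : ∀ n, SimpleGraph (Fin n) ≃ Finset (E n))
    (hφ : ∀ n G, gibbsWeight (lam n) zeta G = weight (lam n) zeta (H n) (φ n G))
    (hH : ∀ n, ∀ T ∈ H n, T.card = 3)
    (F : ∀ n, Finset (Finset (E n))) (Y : ∀ n, SimpleGraph (Fin n) → ℝ)
    (hY : ∀ n G, Y n G = ∑ B ∈ F n, if B ⊆ φ n G then (1 : ℝ) else 0)
    {t r b : ℕ → ℝ} {L ρ : ℝ} (ht : ∀ᶠ n in atTop, 0 < t n) (hr : ∀ᶠ n in atTop, 0 < r n)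
    (hL : Tendsto (fun n => ((F n).card : ℝ) / (t n * r n)) atTop (nhds L))
    (hb : Tendsto (fun n => b n / r n) atTop (nhds 0))
    (h1 : ∀ δ : ℝ, 0 < δ → ∀ᶠ n in atTop, ∀ B ∈ F n,
      |t n * (part (lam n) zeta (H n) B / part (lam n) zeta (H n) ∅) - ρ| ≤ δ)
    (h2 : ∀ δ : ℝ, 0 < δ → ∀ᶠ n in atTop, ∀ B ∈ F n, ∃ X ⊆ F n, (X.card : ℝ) ≤ b n ∧
      ∀ B' ∈ F n \ X,
        t n * part (lam n) zeta (H n) (B ∪ B') ≤ (ρ + δ) * part (lam n) zeta (H n) B)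
    (hρ : 0 ≤ ρ) :
    Tendsto (fun n => gibbsExp n (lam n) zeta (Y n) / r n) atTop (nhds (L * ρ)) ∧
    ∀ ε : ℝ, 0 < ε → Tendsto (fun n => gibbsProb n (lam n) zeta
      {G | |Y n G - gibbsExp n (lam n) zeta (Y n)| ≤ ε * r n}) atTop (nhds 1) := by
  have hZpos : ∀ n, 0 < part (lam n) zeta (H n) ∅ := fun n =>
    part_pos (hlam n) hz1 fun T hT hs => by
      have := hH n T hT
      rw [Finset.subset_empty.1 hs] at this
      simp at this
  have hZ : ∀ n, Zfun n (lam n) zeta ≠ 0 := fun n => Zfun_ne_zero (hlam n) hz1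
  have hE1 : ∀ n, gibbsExp n (lam n) zeta (Y n)
      = ∑ B ∈ F n, part (lam n) zeta (H n) B / part (lam n) zeta (H n) ∅ := fun n => by
    refine Eq.trans ?_ (gibbsExp_sum_indicator (φ n) (hφ n) (F n) fun B => B)
    exact congrArg _ (funext (hY n))
  have hE2 : ∀ n, gibbsExp n (lam n) zeta (fun G => Y n G ^ 2)
      = ∑ B ∈ F n, ∑ B' ∈ F n,
        part (lam n) zeta (H n) (B ∪ B') / part (lam n) zeta (H n) ∅ := fun n => by
    rw [← Finset.sum_product', ← gibbsExp_sum_indicator (φ n) (hφ n) (F n ×ˢ F n)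
      (fun p => p.1 ∪ p.2)]
    refine congrArg _ (funext fun G => ?_)
    rw [hY, sq, Finset.sum_mul_sum, ← Finset.sum_product']
    refine Finset.sum_congr rfl fun p _ => ?_
    by_cases h3 : p.1 ⊆ φ n G <;> by_cases h4 : p.2 ⊆ φ n G <;>
      simp [h3, h4, Finset.union_subset_iff]
  have hmean : Tendsto (fun n => gibbsExp n (lam n) zeta (Y n) / r n) atTop (nhds (L * ρ)) := by
    have h3 := hL.mul_const ρ
    have h4 : Tendsto (fun n => gibbsExp n (lam n) zeta (Y n) / r n
        - ((F n).card : ℝ) / (t n * r n) * ρ) atTop (nhds 0) := by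
      rw [Metric.tendsto_nhds]
      intro ε hε
      have hM : 0 < |L| + 1 := by positivity
      filter_upwards [h1 (ε / (2 * (|L| + 1))) (by positivity), ht, hr,
        hL.eventually_lt_const (lt_of_le_of_lt (le_abs_self L) (lt_add_one |L|))]
        with n hn htn hrn hLn
      rw [Real.dist_eq, sub_zero]
      have h5 : gibbsExp n (lam n) zeta (Y n) / r n - ((F n).card : ℝ) / (t n * r n) * ρ
          = (∑ B ∈ F n, (t n * (part (lam n) zeta (H n) B / part (lam n) zeta (H n) ∅) - ρ))
            / (t n * r n) := by
        rw [hE1, Finset.sum_sub_distrib, ← Finset.mul_sum, Finset.sum_const, nsmul_eq_mul]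
        field_simp
      rw [h5, abs_div, abs_of_pos (mul_pos htn hrn)]
      have h6 : |∑ B ∈ F n, (t n * (part (lam n) zeta (H n) B / part (lam n) zeta (H n) ∅) - ρ)|
          ≤ (F n).card * (ε / (2 * (|L| + 1))) := by
        refine (Finset.abs_sum_le_sum_abs _ _).trans ?_
        refine (Finset.sum_le_sum hn).trans ?_
        rw [Finset.sum_const, nsmul_eq_mul]
      calc _ ≤ (F n).card * (ε / (2 * (|L| + 1))) / (t n * r n) :=
            div_le_div_of_nonneg_right h6 (mul_pos htn hrn).le
        _ = (F n).card / (t n * r n) * (ε / (2 * (|L| + 1))) := by ring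
        _ ≤ (|L| + 1) * (ε / (2 * (|L| + 1))) :=
            mul_le_mul_of_nonneg_right hLn.le (by positivity)
        _ = ε / 2 := by field_simp
        _ < ε := half_lt_self hε
    have h5 := h4.add h3
    rw [zero_add] at h5
    refine h5.congr fun n => ?_
    ring
  refine ⟨hmean, fun ε hε => ?_⟩
  have hvar : ∀ ε : ℝ, 0 < ε → ∀ᶠ n in atTop,
      (gibbsExp n (lam n) zeta (fun G => Y n G ^ 2) - gibbsExp n (lam n) zeta (Y n) ^ 2)
        / r n ^ 2 ≤ ε := by
    intro ε hε
    obtain ⟨δ, hδ, hδε⟩ : ∃ δ : ℝ, 0 < δ ∧ L * ρ * (0 + L * (ρ + δ)) - (L * ρ) ^ 2 < ε := by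
      have h3 : Tendsto (fun δ : ℝ => L * ρ * (0 + L * (ρ + δ)) - (L * ρ) ^ 2)
          (nhdsWithin 0 (Set.Ioi 0)) (nhds (L * ρ * (0 + L * (ρ + 0)) - (L * ρ) ^ 2)) :=
        (Continuous.tendsto (by fun_prop) 0).mono_left nhdsWithin_le_nhds
      have h4 := h3.eventually_lt_const (u := ε) (by ring_nf; exact hε)
      obtain ⟨δ, h5, h6⟩ := (h4.and self_mem_nhdsWithin).exists
      exact ⟨δ, h6, h5⟩
    have h3 := (hmean.mul (hb.add (hL.mul_const (ρ + δ)))).sub (hmean.pow 2)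
    filter_upwards [h2 δ hδ, ht, hr, h3.eventually_lt_const hδε] with n hn htn hrn hlt
    refine le_trans ?_ hlt.le
    have h4 : gibbsExp n (lam n) zeta (fun G => Y n G ^ 2)
        ≤ gibbsExp n (lam n) zeta (Y n) * (b n + (F n).card * ((ρ + δ) / t n)) := by
      rw [hE2, hE1, Finset.sum_mul]
      refine Finset.sum_le_sum fun B hB => ?_
      obtain ⟨X, hXF, hXb, hX⟩ := hn B hB
      set q := part (lam n) zeta (H n) B / part (lam n) zeta (H n) ∅
      have hq : 0 ≤ q := div_nonneg (part_nonneg (hlam n) hz1) (part_nonneg (hlam n) hz1)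
      rw [← Finset.sum_sdiff hXF]
      have h5 : ∑ B' ∈ F n \ X, part (lam n) zeta (H n) (B ∪ B') / part (lam n) zeta (H n) ∅
          ≤ (F n).card * ((ρ + δ) / t n * q) := by
        have h6 : ∑ B' ∈ F n \ X, part (lam n) zeta (H n) (B ∪ B') / part (lam n) zeta (H n) ∅
            ≤ ((F n) \ X).card * ((ρ + δ) / t n * q) := by
          rw [← nsmul_eq_mul]
          refine Finset.sum_le_card_nsmul _ _ _ fun B' hB' => ?_
          rw [← mul_div_assoc]
          refine div_le_div_of_nonneg_right ?_ (hZpos n).le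
          rw [div_mul_eq_mul_div, le_div_iff₀ htn, mul_comm]
          exact hX B' hB'
        refine h6.trans (mul_le_mul_of_nonneg_right ?_ (by positivity))
        exact Nat.cast_le.2 (Finset.card_le_card Finset.sdiff_subset)
      have h7 : ∑ B' ∈ X, part (lam n) zeta (H n) (B ∪ B') / part (lam n) zeta (H n) ∅
          ≤ b n * q := by
        refine (Finset.sum_le_card_nsmul X _ q fun B' _ => ?_).trans ?_
        · exact div_le_div_of_nonneg_right (part_mono (hlam n) hz1 Finset.subset_union_left)
            (hZpos n).le
        · rw [nsmul_eq_mul]; exact mul_le_mul_of_nonneg_right hXb hq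
      calc _ ≤ (F n).card * ((ρ + δ) / t n * q) + b n * q := add_le_add h5 h7
        _ = _ := by ring
    calc _ ≤ (gibbsExp n (lam n) zeta (Y n) * (b n + (F n).card * ((ρ + δ) / t n))
          - gibbsExp n (lam n) zeta (Y n) ^ 2) / r n ^ 2 :=
          div_le_div_of_nonneg_right (sub_le_sub_right h4 _) (by positivity)
      _ = _ := by field_simp
  refine tendsto_order.2 ⟨fun a ha => ?_, fun a ha => Eventually.of_forall fun n =>
    (gibbsProb_le_one (hlam n) hz1 (hZ n) _).trans_lt ha⟩
  filter_upwards [hvar (ε ^ 2 * ((1 - a) / 2)) (mul_pos (by positivity) (by linarith)), hr]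
    with n hn hrn
  refine lt_of_lt_of_le ?_ (gibbsProb_chebyshev (hlam n) hz1 (hZ n) (Y n) (mul_pos hε hrn))
  have h3 : (gibbsExp n (lam n) zeta (fun G => Y n G ^ 2) - gibbsExp n (lam n) zeta (Y n) ^ 2)
      / (ε * r n) ^ 2 ≤ (1 - a) / 2 := by
    rw [mul_pow, mul_comm (ε ^ 2), ← div_div, div_le_iff₀ (by positivity), mul_comm]
    exact hn
  linarith

end Concentration

section Encoding

open TripleSystem

variable {n : ℕ}

/-- Potential edges of a graph on `Fin n`. -/
abbrev Pair (n : ℕ) : Type := {s : Finset (Fin n) // s.card = 2}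

/-- The pairs contained in `t`. -/
def pairsIn (t : Finset (Fin n)) : Finset (Pair n) := Finset.univ.filter (·.1 ⊆ t)

/-- The edge sets of all triangles. -/
def triangles (n : ℕ) : Finset (Finset (Pair n)) :=
  (Finset.powersetCard 3 (Finset.univ : Finset (Fin n))).image pairsIn

lemma mem_pairsIn {t : Finset (Fin n)} {e : Pair n} : e ∈ pairsIn t ↔ e.1 ⊆ t := by
  simp [pairsIn]

lemma card_pairsIn (t : Finset (Fin n)) : (pairsIn t).card = t.card.choose 2 := by
  rw [← Finset.card_powersetCard, ← Finset.card_map (Function.Embedding.subtype _)]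
  congr 1
  ext s
  simp [pairsIn, Finset.mem_powersetCard]

lemma mem_triangles {T : Finset (Pair n)} :
    T ∈ triangles n ↔ ∃ t : Finset (Fin n), t.card = 3 ∧ pairsIn t = T := by
  simp [triangles, Finset.mem_powersetCard]

lemma card_of_mem_triangles {T : Finset (Pair n)} (hT : T ∈ triangles n) : T.card = 3 := by
  obtain ⟨t, ht, rfl⟩ := mem_triangles.1 hT
  rw [card_pairsIn, ht]
  rfl

lemma eq_union_of_mem_pairsIn {t : Finset (Fin n)} (ht : t.card = 3) {a b : Pair n} (hab : a ≠ b)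
    (ha : a ∈ pairsIn t) (hb : b ∈ pairsIn t) : a.1 ∪ b.1 = t := by
  refine Finset.eq_of_subset_of_card_le
    (Finset.union_subset (mem_pairsIn.1 ha) (mem_pairsIn.1 hb)) ?_
  by_contra h
  have h1 : a.1 = a.1 ∪ b.1 := Finset.eq_of_subset_of_card_le Finset.subset_union_left
    (by rw [a.2]; omega)
  have h2 : b.1 = a.1 ∪ b.1 := Finset.eq_of_subset_of_card_le Finset.subset_union_right
    (by rw [b.2]; omega)
  exact hab (Subtype.ext (h1.trans h2.symm))

lemma pairsIn_injOn : Set.InjOn (pairsIn (n := n)) {t | t.card = 3} := by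
  intro t ht t' ht' h
  have h1 : 1 < (pairsIn t).card := by rw [card_pairsIn, ht]; decide
  obtain ⟨a, ha, b, hb, hab⟩ := Finset.one_lt_card.1 h1
  rw [← eq_union_of_mem_pairsIn ht hab ha hb]
  rw [h] at ha hb
  exact eq_union_of_mem_pairsIn ht' hab ha hb

lemma card_triangles (n : ℕ) : (triangles n).card = n.choose 3 := by
  unfold triangles
  rw [Finset.card_image_of_injOn, Finset.card_powersetCard, Finset.card_univ, Fintype.card_fin]
  exact pairsIn_injOn.mono fun t ht => (Finset.mem_powersetCard.1 ht).2

lemma isSystem_triangles (n : ℕ) : IsSystem (triangles n) (n - 2) where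
  card_eq _ hT := card_of_mem_triangles hT
  linear := by
    intro T hT T' hT' a b hab ha hb ha' hb'
    obtain ⟨t, ht, rfl⟩ := mem_triangles.1 hT
    obtain ⟨t', ht', rfl⟩ := mem_triangles.1 hT'
    rw [← eq_union_of_mem_pairsIn ht hab ha hb, ← eq_union_of_mem_pairsIn ht' hab ha' hb']
  regular := by
    intro e
    have h1 : (triangles n).filter (e ∈ ·) = (e.1ᶜ).image fun w => pairsIn (insert w e.1) := by
      ext T
      simp only [Finset.mem_filter, Finset.mem_image, mem_triangles, Finset.mem_compl]
      constructor
      · rintro ⟨⟨t, ht, rfl⟩, he⟩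
        have hs := mem_pairsIn.1 he
        have h2 : (t \ e.1).card = 1 := by
          rw [Finset.card_sdiff_of_subset hs, ht, e.2]
        obtain ⟨w, hw⟩ := Finset.card_eq_one.1 h2
        have hw' : w ∈ t \ e.1 := by simp [hw]
        refine ⟨w, (Finset.mem_sdiff.1 hw').2, ?_⟩
        rw [Finset.insert_eq, ← hw, Finset.sdiff_union_of_subset hs]
      · rintro ⟨w, hw, rfl⟩
        refine ⟨⟨_, ?_, rfl⟩, mem_pairsIn.2 (Finset.subset_insert _ _)⟩
        rw [Finset.card_insert_of_notMem hw, e.2]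
    rw [h1, Finset.card_image_of_injOn, Finset.card_compl, Fintype.card_fin, e.2]
    intro w hw w' hw' h
    simp only [Finset.coe_compl, Set.mem_compl_iff, Finset.mem_coe] at hw hw'
    have h2 := pairsIn_injOn (by simp [Finset.card_insert_of_notMem hw, e.2])
      (by simp [Finset.card_insert_of_notMem hw', e.2]) h
    have h3 : w ∈ insert w' e.1 := h2 ▸ Finset.mem_insert_self w e.1
    exact (Finset.mem_insert.1 h3).resolve_right hw

/-- Encoding of graphs by their sets of edges. -/
def graphEquiv (n : ℕ) : SimpleGraph (Fin n) ≃ Finset (Pair n) where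
  toFun G := Finset.univ.filter fun e => G.IsClique (e.1 : Set (Fin n))
  invFun S :=
    { Adj := fun u v => u ≠ v ∧ ∃ e ∈ S, e.1 = {u, v}
      symm := ⟨fun u v ⟨h, e, he, h1⟩ => ⟨h.symm, e, he, h1.trans (Finset.pair_comm u v)⟩⟩
      loopless := ⟨fun u h => h.1 rfl⟩ }
  left_inv G := by
    ext u v
    simp only [Finset.mem_filter, Finset.mem_univ, true_and]
    constructor
    · rintro ⟨huv, e, he, h⟩
      rw [h] at he
      exact he (by simp) (by simp) huv
    · intro h
      refine ⟨h.ne, ⟨{u, v}, Finset.card_pair h.ne⟩, ?_, rfl⟩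
      rw [Finset.coe_pair, SimpleGraph.isClique_pair]
      exact fun _ => h
  right_inv S := by
    ext e
    simp only [Finset.mem_filter, Finset.mem_univ, true_and]
    obtain ⟨u, v, huv, he⟩ := Finset.card_eq_two.1 e.2
    rw [he, Finset.coe_pair, SimpleGraph.isClique_pair]
    constructor
    · intro h
      obtain ⟨-, e', he', h'⟩ := h huv
      rwa [Subtype.ext (he.trans h'.symm)]
    · exact fun h _ => ⟨huv, e, h, he⟩

lemma mem_graphEquiv {G : SimpleGraph (Fin n)} {e : Pair n} :
    e ∈ graphEquiv n G ↔ G.IsClique (e.1 : Set (Fin n)) := by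
  simp [graphEquiv]

lemma toFinset_mk (u v : Fin n) : s(u, v).toFinset = {u, v} := by
  ext
  simp

lemma edgeCount_eq (G : SimpleGraph (Fin n)) : edgeCount G = (graphEquiv n G).card := by
  unfold edgeCount
  rw [Nat.card_eq_fintype_card, ← SimpleGraph.edgeFinset_card]
  refine Finset.card_bij (fun e he => ⟨e.toFinset, Sym2.card_toFinset_of_not_isDiag e
    (G.not_isDiag_of_mem_edgeFinset he)⟩) ?_ ?_ ?_
  · intro e he
    rw [mem_graphEquiv]
    induction e with
    | h u v =>
      rw [SimpleGraph.mem_edgeFinset, SimpleGraph.mem_edgeSet] at he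
      change G.IsClique (s(u, v).toFinset : Set (Fin n))
      rw [toFinset_mk, Finset.coe_pair, SimpleGraph.isClique_pair]
      exact fun _ => he
  · intro e _ e' _ h
    have h1 : e.toFinset = e'.toFinset := congrArg Subtype.val h
    refine Sym2.ext fun v => ?_
    rw [← Sym2.mem_toFinset, ← Sym2.mem_toFinset, h1]
  · intro e he
    obtain ⟨u, v, huv, h⟩ := Finset.card_eq_two.1 e.2
    rw [mem_graphEquiv, h, Finset.coe_pair, SimpleGraph.isClique_pair] at he
    refine ⟨s(u, v), by simpa using he huv, Subtype.ext ?_⟩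
    exact (toFinset_mk u v).trans h.symm

lemma pairsIn_subset_graphEquiv {G : SimpleGraph (Fin n)} {t : Finset (Fin n)} :
    pairsIn t ⊆ graphEquiv n G ↔ G.IsClique (t : Set (Fin n)) := by
  constructor
  · intro h u hu v hv huv
    have h1 : (⟨{u, v}, Finset.card_pair huv⟩ : Pair n) ∈ pairsIn t :=
      mem_pairsIn.2 (Finset.insert_subset hu (Finset.singleton_subset_iff.2 hv))
    exact mem_graphEquiv.1 (h h1) (by simp) (by simp) huv
  · intro h e he
    exact mem_graphEquiv.2 (h.subset (mem_pairsIn.1 he))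

lemma triCount_eq (G : SimpleGraph (Fin n)) :
    triCount G = ((triangles n).filter (· ⊆ graphEquiv n G)).card := by
  unfold triCount
  rw [Nat.card_eq_fintype_card, Fintype.card_subtype]
  refine Finset.card_bij (fun t _ => pairsIn t) ?_ ?_ ?_
  · intro t ht
    simp only [Finset.mem_filter, Finset.mem_univ, true_and] at ht
    exact Finset.mem_filter.2 ⟨mem_triangles.2 ⟨t, ht.card_eq, rfl⟩,
      pairsIn_subset_graphEquiv.2 ht.isClique⟩
  · intro t ht t' ht' h
    simp only [Finset.mem_filter, Finset.mem_univ, true_and] at ht ht'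
    exact pairsIn_injOn ht.card_eq ht'.card_eq h
  · intro T hT
    obtain ⟨hT, hG⟩ := Finset.mem_filter.1 hT
    obtain ⟨t, ht, rfl⟩ := mem_triangles.1 hT
    refine ⟨t, ?_, rfl⟩
    simp only [Finset.mem_filter, Finset.mem_univ, true_and]
    exact ⟨pairsIn_subset_graphEquiv.1 hG, ht⟩

lemma gibbsWeight_eq (lam zeta : ℝ) (G : SimpleGraph (Fin n)) :
    gibbsWeight lam zeta G = weight lam zeta (triangles n) (graphEquiv n G) := by
  rw [gibbsWeight, weight, edgeCount_eq, triCount_eq]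

end Encoding

section Triangles

open TripleSystem

variable {E : Type*} [DecidableEq E] {N : ℕ} {H : Finset (Finset E)} {A T : Finset E} {e : E}

lemma TripleSystem.IsSystem.free_of_card_le_one (hH : IsSystem H N) (hA : A.card ≤ 1)
    (he : e ∉ A) : Free H H A e where
  sub := subset_rfl
  mem_of_disjoint _ hT _ := hT
  notMem := he
  not_subset T hT hs := by
    have h1 := Finset.card_le_card hs
    have h2 := Finset.card_insert_le e A
    have h3 := hH.card_eq T hT
    omega

lemma TripleSystem.IsSystem.free_erase (hH : IsSystem H N) (hT : T ∈ H) (he : e ∉ T) :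
    Free H (H.erase T) T e where
  sub := Finset.erase_subset _ _
  mem_of_disjoint T' hT' hd := by
    refine Finset.mem_erase.2 ⟨?_, hT'⟩
    rintro rfl
    have h1 := hH.card_eq T' hT'
    rw [disjoint_self.1 hd] at h1
    simp at h1
  notMem := he
  not_subset T' hT' hs := by
    obtain ⟨hne, hT'⟩ := Finset.mem_erase.1 hT'
    have h1 : 1 < (T'.erase e).card := by
      have := Finset.pred_card_le_card_erase (s := T') (a := e)
      have := hH.card_eq T' hT'
      omega
    obtain ⟨a, ha, b, hb, hab⟩ := Finset.one_lt_card.1 h1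
    have h2 : T'.erase e ⊆ T := Finset.subset_insert_iff.1 hs
    exact hne (hH.linear T' hT' T hT a b hab (Finset.mem_of_mem_erase ha)
      (Finset.mem_of_mem_erase hb) (h2 ha) (h2 hb))

lemma TripleSystem.IsSystem.card_filter_not_disjoint_le (hH : IsSystem H N) (hT : T ∈ H) :
    (H.filter fun T' => ¬ Disjoint T T').card ≤ 3 * N := by
  calc _ ≤ (T.biUnion fun u => H.filter (u ∈ ·)).card := by
        refine Finset.card_le_card fun T' hT' => ?_
        obtain ⟨h1, h2⟩ := Finset.mem_filter.1 hT'
        obtain ⟨u, hu, hu'⟩ := Finset.not_disjoint_iff.1 h2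
        exact Finset.mem_biUnion.2 ⟨u, hu, Finset.mem_filter.2 ⟨h1, hu'⟩⟩
    _ ≤ T.card * N := Finset.card_biUnion_le_card_mul _ _ _ fun u _ => (hH.regular u).le
    _ = 3 * N := by rw [hH.card_eq T hT]

end Triangles

section Density

open TripleSystem

variable {lam : ℕ → ℝ} {c d zeta : ℝ}

lemma tendsto_choose_div_pow (k : ℕ) :
    Tendsto (fun n : ℕ => (n.choose k : ℝ) / (n : ℝ) ^ k) atTop (nhds (1 / k.factorial)) := by
  have h1 : ∀ᶠ n : ℕ in atTop, (n : ℝ) ^ k / k.factorial ≠ 0 := by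
    filter_upwards [eventually_gt_atTop 0] with n hn
    positivity
  have h2 := (((Asymptotics.isEquivalent_iff_tendsto_one h1).1
    (isEquivalent_choose k)).mul_const (1 / (k.factorial : ℝ)))
  rw [one_mul] at h2
  refine h2.congr' ?_
  filter_upwards [eventually_gt_atTop 0] with n hn
  simp only [Pi.div_apply]
  field_simp

lemma rpow_three_halves {x : ℝ} (hx : 0 ≤ x) : x ^ ((3 : ℝ) / 2) = Real.sqrt x ^ 3 := by
  rw [Real.sqrt_eq_rpow, ← Real.rpow_natCast, ← Real.rpow_mul hx]
  norm_num

lemma eventually_rpow_three_halves_pos :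
    ∀ᶠ n : ℕ in atTop, (0 : ℝ) < (n : ℝ) ^ ((3 : ℝ) / 2) := by
  filter_upwards [eventually_gt_atTop 0] with n hn
  positivity

lemma eventually_sqrt_natCast_pos : ∀ᶠ n : ℕ in atTop, 0 < Real.sqrt n :=
  tendsto_sqrt_natCast.eventually_gt_atTop 0

lemma tendsto_natCast_div_rpow_three_halves :
    Tendsto (fun n : ℕ => (n : ℝ) / (n : ℝ) ^ ((3 : ℝ) / 2)) atTop (nhds 0) := by
  refine (tendsto_inv_atTop_zero.comp tendsto_sqrt_natCast).congr' ?_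
  filter_upwards [eventually_sqrt_natCast_pos] with n hs
  rw [rpow_three_halves (Nat.cast_nonneg n), Function.comp_apply]
  nth_rw 2 [← Real.sq_sqrt (Nat.cast_nonneg (α := ℝ) n)]
  field_simp

/-- Law of large numbers for the number of edges. -/
lemma edge_concentration (hlam : ∀ n, 0 < lam n)
    (hlc : Tendsto (fun n : ℕ => Real.sqrt n * lam n) atTop (nhds c))
    (hz : 0 < zeta) (hz1 : zeta ≤ 1) (hd0 : 0 < d) (hdc : d < c)
    (hd : d = c * Real.exp (-(zeta * d ^ 2))) (hκ : 2 * zeta * c ^ 2 < 1) :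
    Tendsto (fun n : ℕ => gibbsExp n (lam n) zeta (fun G => (edgeCount G : ℝ))
        / (n : ℝ) ^ ((3 : ℝ) / 2)) atTop (nhds (1 / 2 * d)) ∧
    ∀ ε : ℝ, 0 < ε → Tendsto (fun n => gibbsProb n (lam n) zeta
      {G | |(edgeCount G : ℝ) - gibbsExp n (lam n) zeta (fun G => (edgeCount G : ℝ))|
        ≤ ε * (n : ℝ) ^ ((3 : ℝ) / 2)}) atTop (nhds 1) := by
  have hsing : ∀ n, Function.Injective (fun e : Pair n => ({e} : Finset (Pair n))) :=
    fun n => Finset.singleton_injective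
  refine count_concentration (H := triangles) (t := fun n => Real.sqrt n)
    (b := fun _ => 1) hlam hz1 graphEquiv (fun n => gibbsWeight_eq _ _)
    (fun n => (isSystem_triangles n).card_eq)
    (fun n => Finset.univ.image fun e : Pair n => ({e} : Finset (Pair n))) _ ?_
    eventually_sqrt_natCast_pos eventually_rpow_three_halves_pos ?_ ?_ ?_ ?_ hd0.le
  · intro n G
    rw [Finset.sum_image fun _ _ _ _ h => hsing n h, edgeCount_eq, Finset.sum_boole]
    simp
  · refine (tendsto_choose_div_pow 2).congr fun n => ?_
    rw [Finset.card_image_of_injective _ (hsing n), Finset.card_univ, Fintype.card_finset_len,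
      Fintype.card_fin, rpow_three_halves (Nat.cast_nonneg n)]
    nth_rw 1 [← Real.sq_sqrt (Nat.cast_nonneg (α := ℝ) n)]
    ring
  · refine squeeze_zero' ?_ ?_ tendsto_natCast_div_rpow_three_halves
    · exact Eventually.of_forall fun n => by positivity
    · filter_upwards [eventually_ge_atTop 1] with n hn
      exact div_le_div_of_nonneg_right (Nat.one_le_cast.2 hn) (by positivity)
  · intro δ hδ
    filter_upwards [eventually_marg isSystem_triangles hlam hlc hz hz1 hd0 hdc hd hκ 0 hδ]
      with n hn B hB
    obtain ⟨e, -, rfl⟩ := Finset.mem_image.1 hB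
    exact hn (triangles n) ∅ e (by simp)
      ((isSystem_triangles n).free_of_card_le_one (by simp) (by simp))
  · intro δ hδ
    filter_upwards [eventually_marg isSystem_triangles hlam hlc hz hz1 hd0 hdc hd hκ 1 hδ]
      with n hn B hB
    refine ⟨{B}, Finset.singleton_subset_iff.2 hB, by simp, fun B' hB' => ?_⟩
    obtain ⟨e, -, rfl⟩ := Finset.mem_image.1 hB
    rw [Finset.mem_sdiff, Finset.mem_singleton] at hB'
    obtain ⟨hB', hne⟩ := hB'
    obtain ⟨f, -, rfl⟩ := Finset.mem_image.1 hB'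
    have hef : f ∉ ({e} : Finset (Pair n)) := fun h => hne (by rw [Finset.mem_singleton.1 h])
    have h1 := hn (triangles n) {e} f (by simp)
      ((isSystem_triangles n).free_of_card_le_one (by simp) hef)
    have hpos : 0 < part (lam n) zeta (triangles n) {e} :=
      part_pos (hlam n) hz1 fun T hT hs => by
        have h2 := Finset.card_le_card hs
        rw [card_of_mem_triangles hT, Finset.card_singleton] at h2
        omega
    have h2 : Real.sqrt n * marg (lam n) zeta (triangles n) {e} f ≤ d + δ := by
      linarith [le_abs_self (Real.sqrt n * marg (lam n) zeta (triangles n) {e} f - d)]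
    rw [marg, ← mul_div_assoc, div_le_iff₀ hpos, Finset.insert_eq, Finset.union_comm] at h2
    exact h2

/-- Law of large numbers for the number of triangles. -/
lemma triangle_concentration (hlam : ∀ n, 0 < lam n)
    (hlc : Tendsto (fun n : ℕ => Real.sqrt n * lam n) atTop (nhds c))
    (hz : 0 < zeta) (hz1 : zeta ≤ 1) (hd0 : 0 < d) (hdc : d < c)
    (hd : d = c * Real.exp (-(zeta * d ^ 2))) (hκ : 2 * zeta * c ^ 2 < 1) :
    Tendsto (fun n : ℕ => gibbsExp n (lam n) zeta (fun G => (triCount G : ℝ))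
        / (n : ℝ) ^ ((3 : ℝ) / 2)) atTop (nhds (1 / 6 * ((1 - zeta) * d ^ 3))) ∧
    ∀ ε : ℝ, 0 < ε → Tendsto (fun n => gibbsProb n (lam n) zeta
      {G | |(triCount G : ℝ) - gibbsExp n (lam n) zeta (fun G => (triCount G : ℝ))|
        ≤ ε * (n : ℝ) ^ ((3 : ℝ) / 2)}) atTop (nhds 1) := by
  have hρ : 0 ≤ (1 - zeta) * d ^ 3 := mul_nonneg (sub_nonneg.2 hz1) (pow_nonneg hd0.le 3)
  refine count_concentration (H := triangles) (t := fun n => Real.sqrt n ^ 3)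
    (b := fun n => 3 * n) hlam hz1 graphEquiv (fun n => gibbsWeight_eq _ _)
    (fun n => (isSystem_triangles n).card_eq) triangles _ ?_
    ?_ eventually_rpow_three_halves_pos ?_ ?_ ?_ ?_ hρ
  · intro n G
    rw [triCount_eq, Finset.sum_boole]
  · filter_upwards [eventually_sqrt_natCast_pos] with n hs
    positivity
  · have h := tendsto_choose_div_pow 3
    rw [show Nat.factorial 3 = 6 from rfl, Nat.cast_ofNat] at h
    refine h.congr fun n => ?_
    rw [card_triangles, rpow_three_halves (Nat.cast_nonneg n)]
    nth_rw 1 [← Real.sq_sqrt (Nat.cast_nonneg (α := ℝ) n)]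
    ring
  · have h := tendsto_natCast_div_rpow_three_halves.const_mul 3
    rw [mul_zero] at h
    exact h.congr fun n => by ring
  · intro δ hδ
    filter_upwards [eventually_triple isSystem_triangles hlam hlc hz hz1 hd0 hdc hd hκ 0 hδ]
      with n hn T hT
    have h1 := hn (triangles n) ∅ T hT (by simp)
      (fun u _ => (isSystem_triangles n).free_of_card_le_one (by simp) (by simp)) hT
    rwa [Finset.empty_union] at h1
  · intro δ hδ
    filter_upwards [eventually_triple isSystem_triangles hlam hlc hz hz1 hd0 hdc hd hκ 3 hδ]
      with n hn T hT
    have hsys := isSystem_triangles n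
    refine ⟨(triangles n).filter fun T' => ¬ Disjoint T T', Finset.filter_subset _ _, ?_,
      fun T' hT' => ?_⟩
    · have h1 := hsys.card_filter_not_disjoint_le hT
      exact_mod_cast h1.trans (Nat.mul_le_mul_left 3 (Nat.sub_le n 2))
    · obtain ⟨hT', hdisj⟩ := Finset.mem_sdiff.1 hT'
      have hdisj : Disjoint T T' := by
        by_contra h
        exact hdisj (Finset.mem_filter.2 ⟨hT', h⟩)
      have hfree : ∀ u ∈ T', Free (triangles n) ((triangles n).erase T) T u := fun u hu =>
        hsys.free_erase hT (Finset.disjoint_right.1 hdisj hu)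
      obtain ⟨u, hu⟩ : T'.Nonempty := by
        rw [← Finset.card_pos, card_of_mem_triangles hT']
        norm_num
      have hpos : 0 < part (lam n) zeta ((triangles n).erase T) T :=
        part_pos (hlam n) hz1 (hfree u hu).not_subset'
      have h1 := hn ((triangles n).erase T) T T'
        ((hfree u hu).mem_of_disjoint T' hT' hdisj.symm) (card_of_mem_triangles hT).le hfree hT'
      have h2 := (sub_le_iff_le_add'.1 ((le_abs_self _).trans h1))
      rw [← mul_div_assoc, div_le_iff₀ hpos] at h2
      rw [part_erase hT Finset.subset_union_left, part_erase hT subset_rfl]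
      calc _ = (1 - zeta) * (Real.sqrt n ^ 3
            * part (lam n) zeta ((triangles n).erase T) (T ∪ T')) := by ring
        _ ≤ (1 - zeta) * (((1 - zeta) * d ^ 3 + δ)
            * part (lam n) zeta ((triangles n).erase T) T) :=
          mul_le_mul_of_nonneg_left h2 (sub_nonneg.2 hz1)
        _ = _ := by ring

end Density

section Lambert

variable {W : ℝ → ℝ} {c η zeta : ℝ}

lemma IsLambertW.pos (hW : IsLambertW W) {x : ℝ} (hx : 0 < x) : 0 < W x := by
  obtain ⟨h1, h2, -⟩ := hW x hx.le
  refine h1.lt_of_ne fun h => ?_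
  rw [← h, zero_mul] at h2
  exact hx.ne h2

lemma IsLambertW.div_self_eq (hW : IsLambertW W) {x : ℝ} (hx : 0 < x) :
    W x / x = Real.exp (-W x) := by
  rw [Real.exp_neg, div_eq_iff hx.ne', eq_inv_mul_iff_mul_eq₀ (Real.exp_pos _).ne', mul_comm]
  exact (hW x hx.le).2.1

lemma IsLambertW.mono (hW : IsLambertW W) {x y : ℝ} (hx : 0 ≤ x) (hxy : x ≤ y) : W x ≤ W y := by
  obtain ⟨hx1, hx2, -⟩ := hW x hx
  obtain ⟨hy1, hy2, -⟩ := hW y (hx.trans hxy)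
  by_contra! h
  have h1 : W y * Real.exp (W y) < W x * Real.exp (W x) :=
    mul_lt_mul h (Real.exp_le_exp.2 h.le) (Real.exp_pos _) hx1
  linarith

lemma zeta_pos_of_zetaLHS_lt_one (hz : 0 ≤ zeta) (h : zetaLHS W c zeta < 1) : 0 < zeta := by
  refine hz.lt_of_ne fun h0 => ?_
  rw [← h0, zetaLHS, if_pos rfl] at h
  norm_num at h

/-- The condition `c < c̄(η)` forces `2ζc² < 2/e`. -/
lemma two_mul_zeta_mul_sq_lt (hW : IsLambertW W) (hc : 0 < c) (hz : 0 < zeta) (hz1 : zeta ≤ 1)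
    (hcbar : LtCbar W c (zetaLHS W c zeta)) : 2 * zeta * c ^ 2 < 2 / Real.exp 1 := by
  by_contra! h
  have he := Real.exp_pos 1
  have hx : 0 < 2 / Real.exp 1 := by positivity
  have hy : 0 < 2 * zeta * c ^ 2 := by positivity
  have hs : 0 < etaStar W := by
    unfold etaStar
    have := hW.pos hx
    positivity
  have h1 : zetaLHS W c zeta ≤ (1 - zeta) * etaStar W := by
    rw [zetaLHS, if_neg hz.ne', etaStar, hW.div_self_eq hx, hW.div_self_eq hy]
    refine mul_le_mul_of_nonneg_left ?_ (sub_nonneg.2 hz1)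
    exact Real.rpow_le_rpow (Real.exp_pos _).le
      (Real.exp_le_exp.2 (neg_le_neg (hW.mono hx.le h))) (by norm_num)
  have h2 : zetaLHS W c zeta / etaStar W ≤ 1 - zeta := (div_le_iff₀ hs).2 h1
  have h3 := hcbar (h1.trans_lt (by nlinarith))
  set q := Real.exp 1 * (1 - zetaLHS W c zeta / etaStar W)
  have h4 : Real.exp 1 * zeta ≤ q := mul_le_mul_of_nonneg_left (by linarith) he.le
  have hq : 0 < q := lt_of_lt_of_le (by positivity) h4
  have h5 : c * Real.sqrt q < 1 := (lt_div_iff₀ (Real.sqrt_pos.2 hq)).1 h3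
  have h6 : c ^ 2 * q < 1 := by
    rw [← Real.sq_sqrt hq.le, ← mul_pow]
    exact pow_lt_one₀ (by positivity) h5 two_ne_zero
  rw [div_le_iff₀ he] at h
  nlinarith [mul_le_mul_of_nonneg_left h4 (sq_nonneg c)]

/-- The edge density parameter `√(W(2ζc²)/(2ζ))` solves the fixed point equation
`d = c e^{-ζd²}`. -/
lemma sqrt_lambert_fixed_point (hW : IsLambertW W) (hc : 0 < c) (hz : 0 < zeta) :
    Real.sqrt (W (2 * zeta * c ^ 2) / (2 * zeta))
      = c * Real.exp (-(zeta * Real.sqrt (W (2 * zeta * c ^ 2) / (2 * zeta)) ^ 2)) := by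
  have hx : 0 < 2 * zeta * c ^ 2 := by positivity
  have hw := hW.pos hx
  have h1 := hW.div_self_eq hx
  set w := W (2 * zeta * c ^ 2)
  rw [Real.sq_sqrt (by positivity), Real.sqrt_eq_iff_mul_self_eq (by positivity) (by positivity)]
  have h2 : -(zeta * (w / (2 * zeta))) = -w / 2 := by field_simp
  rw [h2, mul_mul_mul_comm, ← Real.exp_add, add_halves, ← h1]
  field_simp

end Lambert

/-- **Lemma (edge and triangle density of the Gibbs measure `μ_{λ,ζ}`).** -/
theorem gibbs_density_estimate
    (W : ℝ → ℝ) (hW : IsLambertW W)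
    (c η : ℝ) (hc : 0 < c) (hη : η ∈ Set.Ico (0 : ℝ) 1) (hcbar : LtCbar W c η)
    (zeta : ℝ) (hzeta : zeta ∈ Set.Icc (0 : ℝ) 1) (hzetaEq : zetaLHS W c zeta = η)
    (lam : ℕ → ℝ) (hlam : ∀ n, 0 < lam n)
    (hlc : Tendsto (fun n : ℕ => Real.sqrt n * lam n) atTop (nhds c)) :
    Tendsto (fun n : ℕ =>
        gibbsExp n (lam n) zeta (fun G => (edgeCount G : ℝ)) / (n : ℝ) ^ ((3 : ℝ) / 2))
      atTop (nhds ((1 / 2) * Real.sqrt (W (2 * zeta * c ^ 2) / (2 * zeta)))) ∧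
    Tendsto (fun n : ℕ =>
        gibbsExp n (lam n) zeta (fun G => (triCount G : ℝ)) / (n : ℝ) ^ ((3 : ℝ) / 2))
      atTop
      (nhds (((1 - zeta) / 6) * (W (2 * zeta * c ^ 2) / (2 * zeta)) ^ ((3 : ℝ) / 2))) ∧
    ∀ ε : ℝ, 0 < ε →
      Tendsto (fun n : ℕ =>
          gibbsProb n (lam n) zeta
            {G |
              |(edgeCount G : ℝ) - gibbsExp n (lam n) zeta (fun G => (edgeCount G : ℝ))| ≤
                ε * gibbsExp n (lam n) zeta (fun G => (edgeCount G : ℝ)) ∧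
              |(triCount G : ℝ) - gibbsExp n (lam n) zeta (fun G => (triCount G : ℝ))| ≤
                ε * (gibbsExp n (lam n) zeta (fun G => (triCount G : ℝ)) +
                  (n : ℝ) ^ ((3 : ℝ) / 2))})
        atTop (nhds 1) := by
  have hz := zeta_pos_of_zetaLHS_lt_one hzeta.1 (hzetaEq.trans_lt hη.2)
  have hz1 := hzeta.2
  subst hzetaEq
  have hκ : 2 * zeta * c ^ 2 < 1 := by
    refine (two_mul_zeta_mul_sq_lt hW hc hz hz1 hcbar).trans ?_
    rw [div_lt_one (Real.exp_pos 1)]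
    exact lt_trans (by norm_num) Real.exp_one_gt_d9
  have hd := sqrt_lambert_fixed_point hW hc hz
  have hw : 0 < W (2 * zeta * c ^ 2) := hW.pos (by positivity)
  rw [rpow_three_halves (by positivity)]
  have hd0 : 0 < Real.sqrt (W (2 * zeta * c ^ 2) / (2 * zeta)) := by positivity
  set d := Real.sqrt (W (2 * zeta * c ^ 2) / (2 * zeta))
  have hdc : d < c := by
    rw [hd]
    refine mul_lt_of_lt_one_right hc (Real.exp_lt_one_iff.2 ?_)
    rw [neg_lt_zero]
    positivity
  obtain ⟨hE, hE'⟩ := edge_concentration hlam hlc hz hz1 hd0 hdc hd hκ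
  obtain ⟨hX, hX'⟩ := triangle_concentration hlam hlc hz hz1 hd0 hdc hd hκ
  refine ⟨hE, by convert hX using 2; ring, fun ε hε => ?_⟩
  have hlow := ((hE' (ε * (d / 4)) (by positivity)).add (hX' ε hε)).sub_const 1
  rw [add_sub_cancel_right] at hlow
  have hZ : ∀ n, Zfun n (lam n) zeta ≠ 0 := fun n => Zfun_ne_zero (hlam n) hz1
  refine tendsto_of_tendsto_of_tendsto_of_le_of_le' hlow tendsto_const_nhds ?_
    (Eventually.of_forall fun n => gibbsProb_le_one (hlam n) hz1 (hZ n) _)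
  filter_upwards [eventually_rpow_three_halves_pos,
    hE.eventually_const_lt (show d / 4 < 1 / 2 * d by linarith)] with n hn hdn
  refine (le_gibbsProb_inter (hlam n) hz1 (hZ n) _ _).trans
    (gibbsProb_mono (hlam n) hz1 fun G hG => ⟨hG.1.trans ?_, hG.2.trans ?_⟩)
  · rw [mul_assoc]
    exact mul_le_mul_of_nonneg_left ((lt_div_iff₀ hn).1 hdn).le hε.le
  · exact mul_le_mul_of_nonneg_left
      (le_add_of_nonneg_left (gibbsExp_nonneg (hlam n) hz1 fun G => Nat.cast_nonneg _)) hε.le
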